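/- There exists a constant C > 0 such that for all n, k ∈ ℕ: if U_n is Haar distributed on O(n) then E[(Tr(U_n^k))²] ≤ C·min{k, n}, and if U_n is Haar distributed on Sp(2n) then E[(Tr(U_n^k))²] ≤ C·min{k, n}. -/

import Mathlib

open MeasureTheory ProbabilityTheory Matrix Filter Topology

noncomputable section

instance matMS (n m R : Type*) [MeasurableSpace R] : MeasurableSpace (Matrix n m R) :=
  MeasurableSpace.pi

/-- `μ` is the Haar probability measure on the orthogonal group `O(n)`. -/
def IsHaarON (n : ℕ) (μ : Measure (Matrix (Fin n) (Fin n) ℝ)) : Prop :=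
  IsProbabilityMeasure μ ∧
  μ ((Matrix.orthogonalGroup (Fin n) ℝ : Set (Matrix (Fin n) (Fin n) ℝ))ᶜ) = 0 ∧
  ∀ V : Matrix (Fin n) (Fin n) ℝ, V ∈ Matrix.orthogonalGroup (Fin n) ℝ →
    Measure.map (fun U => V * U) μ = μ

/-- The standard symplectic form matrix `J = [[0, Iₙ], [−Iₙ, 0]]`. -/
def sympJ (n : ℕ) : Matrix (Fin n ⊕ Fin n) (Fin n ⊕ Fin n) ℂ :=
  Matrix.fromBlocks 0 1 (-1) 0

/-- Membership in the compact symplectic group `Sp(2n)`. -/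
def InCompactSp (n : ℕ) (U : Matrix (Fin n ⊕ Fin n) (Fin n ⊕ Fin n) ℂ) : Prop :=
  U ∈ Matrix.unitaryGroup (Fin n ⊕ Fin n) ℂ ∧
    U * sympJ n * U.transpose = sympJ n ∧ U.transpose * sympJ n * U = sympJ n

/-- `μ` is the Haar probability measure on `Sp(2n)`. -/
def IsHaarSp (n : ℕ) (μ : Measure (Matrix (Fin n ⊕ Fin n) (Fin n ⊕ Fin n) ℂ)) : Prop :=
  IsProbabilityMeasure μ ∧
  μ {U | ¬ InCompactSp n U} = 0 ∧
  ∀ V, InCompactSp n V → Measure.map (fun U => V * U) μ = μ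

namespace TraceMoment

section

/-- Laurent polynomials in `m` variables. -/
abbrev Laurent (m : ℕ) := AddMonoidAlgebra ℂ (Fin m → ℤ)

variable {m : ℕ}

/-- Multiplication of the coefficient at `v` by `φ v`. -/
def diagMap (φ : (Fin m → ℤ) → ℂ) : Laurent m →ₗ[ℂ] Laurent m where
  toFun g := .ofCoeff (Finsupp.onFinset g.coeff.support (fun v => φ v * g.coeff v)
    (fun v hv => by
      rw [Finsupp.mem_support_iff]
      exact right_ne_zero_of_mul hv))
  map_add' g h := by ext v; simp [mul_add]
  map_smul' c g := by ext v; simp; ring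

@[simp] lemma coeff_diagMap (φ : (Fin m → ℤ) → ℂ) (g : Laurent m) (v : Fin m → ℤ) :
    (diagMap φ g).coeff v = φ v * g.coeff v := rfl

lemma diagMap_single (φ : (Fin m → ℤ) → ℂ) (v : Fin m → ℤ) (c : ℂ) :
    diagMap φ (AddMonoidAlgebra.single v c) = AddMonoidAlgebra.single v (φ v * c) := by
  ext w
  by_cases h : v = w
  · subst h; simp
  · simp [h]

/-- The Euler derivation `z_a ∂/∂z_a`. -/
def euler (a : Fin m) : Derivation ℂ (Laurent m) (Laurent m) :=
  Derivation.mk' (diagMap fun v => (v a : ℂ)) (fun g h => by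
    induction g using AddMonoidAlgebra.induction_linear with
    | zero => simp
    | add g₁ g₂ h₁ h₂ => simp only [add_mul, map_add, h₁, h₂, smul_eq_mul, mul_add]; ring
    | single v c =>
      induction h using AddMonoidAlgebra.induction_linear with
      | zero => simp
      | add g₁ g₂ h₁ h₂ => simp only [add_mul, map_add, h₁, h₂, smul_eq_mul, mul_add]; ring
      | single w d =>
        simp only [AddMonoidAlgebra.single_mul_single, diagMap_single, smul_eq_mul]
        rw [add_comm w v, ← AddMonoidAlgebra.single_add]
        congr 1
        simp only [Pi.add_apply]; push_cast; ring)

@[simp] lemma coeff_euler (a : Fin m) (g : Laurent m) (v : Fin m → ℤ) :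
    (euler a g).coeff v = v a * g.coeff v := rfl

/-- The Laplacian `∑ (z_a ∂/∂z_a)²`. -/
def lap : Laurent m →ₗ[ℂ] Laurent m := diagMap fun v => ∑ a, (v a : ℂ) ^ 2

lemma lap_eq (g : Laurent m) : lap g = ∑ a, euler a (euler a g) := by
  ext v
  simp [lap, Finset.sum_mul, sq, mul_assoc]

/-- The carré du champ of `lap`. -/
def torusGrad (g h : Laurent m) : Laurent m := ∑ a, euler a g * euler a h

lemma lap_mul (g h : Laurent m) :
    lap (g * h) = g * lap h + h * lap g + 2 * torusGrad g h := by
  simp only [lap_eq, torusGrad, Derivation.leibniz, map_add, smul_eq_mul, Finset.mul_sum,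
    ← Finset.sum_add_distrib]
  exact Finset.sum_congr rfl fun a _ => by ring

/-- The monomial `z_a ^ n`. -/
def zp (a : Fin m) (n : ℤ) : Laurent m := AddMonoidAlgebra.single (Pi.single a n) 1

lemma zp_mul (a : Fin m) (n n' : ℤ) : zp a n * zp a n' = zp a (n + n') := by
  simp [zp, AddMonoidAlgebra.single_mul_single, Pi.single_add]

@[simp] lemma zp_zero (a : Fin m) : zp a 0 = 1 := by
  simp [zp, AddMonoidAlgebra.one_def]

lemma zp_pow (a : Fin m) (n : ℤ) (k : ℕ) : zp a n ^ k = zp a (k * n) := by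
  induction k with
  | zero => simp
  | succ k ih => rw [pow_succ, ih, zp_mul]; congr 1; push_cast; ring

lemma euler_zp (a b : Fin m) (n : ℤ) :
    euler a (zp b n) = if a = b then (n : Laurent m) * zp b n else 0 := by
  have h1 : euler a (zp b n) = ((Pi.single b n : Fin m → ℤ) a : ℂ) • zp b n := by
    change diagMap _ (AddMonoidAlgebra.single _ _) = _
    rw [diagMap_single]
    simp [zp]
  rw [h1]
  split_ifs with h
  · subst h; simp [Algebra.smul_def]
  · simp [h]

lemma coeff_zp_mul (a : Fin m) (n : ℤ) (g : Laurent m) (v : Fin m → ℤ) :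
    (zp a n * g).coeff v = g.coeff (v - Pi.single a n) := by
  rw [zp, AddMonoidAlgebra.coeff_single_mul_apply]
  simp [sub_eq_neg_add]

/-- Laurent power sum `∑ (z_a ^ (2 k) + z_a ^ (-2 k))`. -/
def powSum (m : ℕ) (k : ℕ) : Laurent m := ∑ a, (zp a (2 * k) + zp a (-(2 * k)))

lemma euler_powSum (a : Fin m) (k : ℕ) :
    euler a (powSum m k) = 2 * k * (zp a (2 * k) - zp a (-(2 * k))) := by
  simp only [powSum, map_sum, map_add, euler_zp]
  simp [Finset.sum_add_distrib]
  ring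

lemma lap_powSum (k : ℕ) : lap (powSum m k) = 4 * k ^ 2 * powSum m k := by
  rw [lap_eq]
  have : ∀ a : Fin m, euler a (euler a (powSum m k)) =
      4 * k ^ 2 * (zp a (2 * k) + zp a (-(2 * k))) := by
    intro a
    rw [euler_powSum]
    have h2 : (2 * k : Laurent m) = algebraMap ℂ _ (2 * k) := by
      rw [map_mul, map_natCast, map_ofNat]
    rw [h2, ← Algebra.smul_def, Derivation.map_smul, map_sub, euler_zp, euler_zp, Algebra.smul_def,
      ← h2]
    simp
    ring
  simp_rw [this, powSum, Finset.mul_sum]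

lemma torusGrad_powSum (k l : ℕ) :
    torusGrad (powSum m k) (powSum m l) =
      4 * k * l * (powSum m (k + l) - powSum m (k - l : ℤ).natAbs) := by
  simp only [torusGrad, euler_powSum]
  simp only [powSum, ← Finset.sum_sub_distrib, Finset.mul_sum]
  refine Finset.sum_congr rfl fun a _ => ?_
  have h : zp a (2 * (((k - l : ℤ).natAbs : ℕ) : ℤ)) + zp a (-(2 * (((k - l : ℤ).natAbs : ℕ) : ℤ)))
      = zp a (2 * k - 2 * l) + zp a (2 * l - 2 * k) := by
    rcases Int.natAbs_eq (k - l : ℤ) with h | h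
    · rw [← h]; congr 2 <;> ring
    · have h' : (((k - l : ℤ).natAbs : ℕ) : ℤ) = l - k := by omega
      rw [h', add_comm]; congr 2 <;> ring
  rw [h]
  have e1 := zp_mul a (2 * k) (2 * l)
  have e2 := zp_mul a (2 * k) (-(2 * l))
  have e3 := zp_mul a (-(2 * k)) (2 * l)
  have e4 := zp_mul a (-(2 * k)) (-(2 * l))
  have f1 : (2 * k + 2 * l : ℤ) = 2 * ((k + l : ℕ) : ℤ) := by push_cast; ring
  have f2 : (2 * k + -(2 * l) : ℤ) = 2 * k - 2 * l := by ring
  have f3 : (-(2 * k) + 2 * l : ℤ) = 2 * l - 2 * k := by ring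
  have f4 : (-(2 * k) + -(2 * l) : ℤ) = -(2 * ((k + l : ℕ) : ℤ)) := by push_cast; ring
  rw [f1] at e1
  rw [f2] at e2
  rw [f3] at e3
  rw [f4] at e4
  linear_combination 4 * (k : Laurent m) * l * (e1 - e2 - e3 + e4)

end

section

section identities

variable {R : Type*} [CommRing R]

/-- `∑_{i<k} (x^(k-i) y^i + y^(k-i) x^i)`; for `x y = 1` this is `∑ (x^(k-2i) + x^(2i-k))`. -/
def selfSum (x y : R) (k : ℕ) : R :=
  ∑ i ∈ Finset.range k, (x ^ (k - i) * y ^ i + y ^ (k - i) * x ^ i)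

/-- Cross terms between the pairs `{x, x'}` and `{y, y'}`. -/
def crossSum (x x' y y' : R) (k : ℕ) : R :=
  ∑ i ∈ Finset.range k, ((x ^ i + x' ^ i) * (y ^ (k - i) + y' ^ (k - i)) +
    (x ^ (k - i) + x' ^ (k - i)) * (y ^ i + y' ^ i))

/-- Cross terms between the pair `{x, y}` and the single element `θ`. -/
def fixedSum (x y θ : R) (k : ℕ) : R :=
  ∑ i ∈ Finset.range k, (θ ^ i * (x ^ (k - i) + y ^ (k - i)) + θ ^ (k - i) * (x ^ i + y ^ i))

lemma sum_pow_mul_pow_symm (x y : R) (k : ℕ) :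
    ∑ i ∈ Finset.range k, (x ^ i * y ^ (k - i) + x ^ (k - i) * y ^ i) =
      (x + y) * ∑ i ∈ Finset.range k, x ^ i * y ^ (k - 1 - i) := by
  rw [add_mul, Finset.sum_add_distrib, add_comm]
  congr 1
  · rw [← Finset.sum_range_reflect, Finset.mul_sum]
    refine Finset.sum_congr rfl fun i hi => ?_
    rw [Finset.mem_range] at hi
    rw [show k - (k - 1 - i) = i + 1 by omega, pow_succ]; ring
  · rw [Finset.mul_sum]
    refine Finset.sum_congr rfl fun i hi => ?_
    rw [Finset.mem_range] at hi
    rw [show k - i = k - 1 - i + 1 by omega, pow_succ]; ring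

lemma sum_pow_mul_pow_symm_mul_sub (x y : R) (k : ℕ) :
    (∑ i ∈ Finset.range k, (x ^ i * y ^ (k - i) + x ^ (k - i) * y ^ i)) * (x - y) =
      (x + y) * (x ^ k - y ^ k) := by
  rw [sum_pow_mul_pow_symm, mul_assoc, geom_sum₂_mul]

lemma selfSum_mul (x y : R) (k : ℕ) :
    selfSum x y k * (x - y) = (x ^ k - y ^ k) * (x + y) := by
  rw [mul_comm (x ^ k - y ^ k), ← sum_pow_mul_pow_symm_mul_sub, selfSum]
  congr 1
  exact Finset.sum_congr rfl fun i _ => by ring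

lemma crossSum_mul {x x' y y' : R} (hx : x * x' = 1) (hy : y * y' = 1) (k : ℕ) :
    crossSum x x' y y' k * ((x + x') - (y + y')) =
      2 * ((x ^ k - x' ^ k) * (x - x')) - 2 * ((y ^ k - y' ^ k) * (y - y')) := by
  have h : crossSum x x' y y' k =
      (∑ i ∈ Finset.range k, (x ^ i * y ^ (k - i) + x ^ (k - i) * y ^ i)) +
      (∑ i ∈ Finset.range k, (x ^ i * y' ^ (k - i) + x ^ (k - i) * y' ^ i)) +
      (∑ i ∈ Finset.range k, (x' ^ i * y ^ (k - i) + x' ^ (k - i) * y ^ i)) +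
      (∑ i ∈ Finset.range k, (x' ^ i * y' ^ (k - i) + x' ^ (k - i) * y' ^ i)) := by
    simp only [crossSum, ← Finset.sum_add_distrib]
    exact Finset.sum_congr rfl fun i _ => by ring
  have h1 := sum_pow_mul_pow_symm_mul_sub x y k
  have h2 := sum_pow_mul_pow_symm_mul_sub x y' k
  have h3 := sum_pow_mul_pow_symm_mul_sub x' y k
  have h4 := sum_pow_mul_pow_symm_mul_sub x' y' k
  rw [h]
  set A := ∑ i ∈ Finset.range k, (x ^ i * y ^ (k - i) + x ^ (k - i) * y ^ i)
  set B := ∑ i ∈ Finset.range k, (x ^ i * y' ^ (k - i) + x ^ (k - i) * y' ^ i)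
  set C := ∑ i ∈ Finset.range k, (x' ^ i * y ^ (k - i) + x' ^ (k - i) * y ^ i)
  set D := ∑ i ∈ Finset.range k, (x' ^ i * y' ^ (k - i) + x' ^ (k - i) * y' ^ i)
  have f1 : (x + x') - (y + y') = (x - y) * (1 - x' * y') := by
    linear_combination y' * hx - x' * hy
  have f2 : (x + x') - (y + y') = (x - y') * (1 - x' * y) := by
    linear_combination y * hx - x' * hy
  have f3 : (x + x') - (y + y') = (x' - y) * (1 - x * y') := by
    linear_combination y' * hx - x * hy
  have f4 : (x + x') - (y + y') = (x' - y') * (1 - x * y) := by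
    linear_combination y * hx - x * hy
  have e1 : A * ((x + x') - (y + y')) = (x + y) * (x ^ k - y ^ k) * (1 - x' * y') := by
    rw [f1, ← h1]; ring
  have e2 : B * ((x + x') - (y + y')) = (x + y') * (x ^ k - y' ^ k) * (1 - x' * y) := by
    rw [f2, ← h2]; ring
  have e3 : C * ((x + x') - (y + y')) = (x' + y) * (x' ^ k - y ^ k) * (1 - x * y') := by
    rw [f3, ← h3]; ring
  have e4 : D * ((x + x') - (y + y')) = (x' + y') * (x' ^ k - y' ^ k) * (1 - x * y) := by
    rw [f4, ← h4]; ring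
  have g1 : (x + y) * (1 - x' * y') = x + y - x' - y' := by
    linear_combination -y' * hx - x' * hy
  have g2 : (x + y') * (1 - x' * y) = x + y' - x' - y := by
    linear_combination -y * hx - x' * hy
  have g3 : (x' + y) * (1 - x * y') = x' + y - x - y' := by
    linear_combination -y' * hx - x * hy
  have g4 : (x' + y') * (1 - x * y) = x' + y' - x - y := by
    linear_combination -y * hx - x * hy
  linear_combination e1 + e2 + e3 + e4 + (x ^ k - y ^ k) * g1 + (x ^ k - y' ^ k) * g2
    + (x' ^ k - y ^ k) * g3 + (x' ^ k - y' ^ k) * g4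

lemma fixedSum_mul {z w θ : R} (hz : z * w = 1) (hθ : θ * θ = 1) (k : ℕ) :
    fixedSum (z ^ 2) (w ^ 2) θ k * (z - θ * w) =
      ((z ^ 2) ^ k - (w ^ 2) ^ k) * (z + θ * w) := by
  have h1 := sum_pow_mul_pow_symm_mul_sub (z ^ 2) θ k
  have h2 := sum_pow_mul_pow_symm_mul_sub (w ^ 2) θ k
  have h : fixedSum (z ^ 2) (w ^ 2) θ k =
      (∑ i ∈ Finset.range k, ((z ^ 2) ^ i * θ ^ (k - i) + (z ^ 2) ^ (k - i) * θ ^ i)) +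
      (∑ i ∈ Finset.range k, ((w ^ 2) ^ i * θ ^ (k - i) + (w ^ 2) ^ (k - i) * θ ^ i)) := by
    simp only [fixedSum, ← Finset.sum_add_distrib]
    exact Finset.sum_congr rfl fun i _ => by ring
  rw [h]
  set A := ∑ i ∈ Finset.range k, ((z ^ 2) ^ i * θ ^ (k - i) + (z ^ 2) ^ (k - i) * θ ^ i)
  set B := ∑ i ∈ Finset.range k, ((w ^ 2) ^ i * θ ^ (k - i) + (w ^ 2) ^ (k - i) * θ ^ i)
  set X := (z ^ 2) ^ k
  set Y := (w ^ 2) ^ k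
  set T := θ ^ k
  have f1 : z - θ * w = w * (z ^ 2 - θ) := by linear_combination -z * hz
  have f2 : z - θ * w = -θ * z * (w ^ 2 - θ) := by linear_combination θ * w * hz - z * hθ
  have e1 : A * (z - θ * w) = w * ((z ^ 2 + θ) * (X - T)) := by rw [f1, ← h1]; ring
  have e2 : B * (z - θ * w) = -θ * z * ((w ^ 2 + θ) * (Y - T)) := by rw [f2, ← h2]; ring
  linear_combination e1 + e2 + ((X - T) * z - θ * (Y - T) * w) * hz - (Y - T) * z * hθ

end identities

/-- The types of Weyl denominators that occur. -/
inductive WeylType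
  | evenPlus | oddPlus | oddMinus | evenMinus | symp

namespace WeylType

/-- Exponent of the Weyl weight. -/
def e : WeylType → ℕ
  | evenPlus => 0 | oddPlus => 1 | oddMinus => 1 | evenMinus => 2 | symp => 2

/-- Sign of the Weyl weight under inversion. -/
def κ : WeylType → ℤ
  | evenPlus => 1 | oddPlus => -1 | oddMinus => 1 | evenMinus => -1 | symp => -1

/-- Symmetry sign of the bilinear form. -/
def η : WeylType → ℤ
  | evenPlus => 1 | oddPlus => 1 | oddMinus => 1 | evenMinus => 1 | symp => -1

/-- Multiplicity of the fixed eigenvalue `1`. -/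
def α : WeylType → ℕ
  | evenPlus => 0 | oddPlus => 1 | oddMinus => 0 | evenMinus => 1 | symp => 0

/-- Multiplicity of the fixed eigenvalue `-1`. -/
def β : WeylType → ℕ
  | evenPlus => 0 | oddPlus => 0 | oddMinus => 1 | evenMinus => 1 | symp => 0

/-- Contribution of the fixed eigenvalues to the power sums. -/
def s (t : WeylType) (k : ℕ) : ℤ := t.α + t.β * (-1) ^ k

lemma weight_identity (t : WeylType) {R : Type*} [CommRing R] {z w : R} (hz : z * w = 1) (k : ℕ) :
    ((z ^ 2) ^ k - (w ^ 2) ^ k) * (t.e * (z ^ t.e - t.κ * w ^ t.e)) =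
      (t.α * fixedSum (z ^ 2) (w ^ 2) 1 k + t.β * fixedSum (z ^ 2) (w ^ 2) (-1) k
        + (1 - t.η) * selfSum (z ^ 2) (w ^ 2) k) * (z ^ t.e + t.κ * w ^ t.e) := by
  have h1 := fixedSum_mul hz (θ := 1) (by ring) k
  have h2 := fixedSum_mul hz (θ := -1) (by ring) k
  have h3 := selfSum_mul (z ^ 2) (w ^ 2) k
  cases t <;> simp only [e, κ, η, α, β] <;> push_cast
  · ring
  · linear_combination -h1
  · linear_combination -h2
  · linear_combination - h1 * (z + w) - h2 * (z - w)
  · linear_combination -2 * h3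

lemma s_sum (t : WeylType) (k : ℕ) :
    ∑ i ∈ Finset.range k, (t.s i * t.s (k - i) - t.η * t.s (k - 2 * i : ℤ).natAbs) = 0 := by
  have hpar : ∀ i, ((-1 : ℤ)) ^ (k - 2 * i : ℤ).natAbs = (-1) ^ k := by
    intro i
    rcases Nat.even_or_odd k with h | h
    · rw [h.neg_one_pow, Even.neg_one_pow]; grind
    · rw [h.neg_one_pow, Odd.neg_one_pow]; grind
  have hki : ∀ i ∈ Finset.range k, (-1 : ℤ) ^ (k - i) = (-1) ^ k * (-1) ^ i := by
    intro i hi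
    rw [Finset.mem_range] at hi
    have : (-1 : ℤ) ^ k = (-1) ^ (k - i) * (-1) ^ i := by rw [← pow_add]; congr 1; omega
    rw [this, mul_assoc, ← mul_pow]; simp
  have hsq : ∀ i, ((-1 : ℤ) ^ i) ^ 2 = 1 := fun i => by rw [← pow_mul, mul_comm, pow_mul]; simp
  have hz : (1 + (-1) ^ k) * ∑ i ∈ Finset.range k, (-1 : ℤ) ^ i = 0 := by
    rcases Nat.even_or_odd k with h | h
    · rw [neg_one_geom_sum, if_pos h, mul_zero]
    · rw [h.neg_one_pow]; simp
  rw [← mul_zero ((t.α * t.β : ℕ) : ℤ), ← hz, Finset.mul_sum, Finset.mul_sum]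
  refine Finset.sum_congr rfl fun i hi => ?_
  have h1 := hki i hi
  have h2 := hpar i
  have h3 := hsq i
  cases t <;> simp only [s, η, α, β] <;> rw [h1, h2] <;> push_cast <;>
    first | ring1 | linear_combination ((-1) ^ k : ℤ) * h3

lemma s_add (t : WeylType) (k l : ℕ) : t.s (k + l) = t.s (k - l : ℤ).natAbs := by
  have : (-1 : ℤ) ^ (k + l) = (-1) ^ (k - l : ℤ).natAbs := by
    rcases Nat.even_or_odd (k + l) with h | h
    · rw [h.neg_one_pow, Even.neg_one_pow]; grind
    · rw [h.neg_one_pow, Odd.neg_one_pow]; grind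
  simp [s, this]

end WeylType

end

section

lemma derivation_prod_of_log {R A ι : Type*} [CommRing R] [CommRing A] [Algebra R A]
    (X : Derivation R A A) (s : Finset ι) (f l : ι → A) (h : ∀ i ∈ s, X (f i) = l i * f i) :
    X (∏ i ∈ s, f i) = (∑ i ∈ s, l i) * ∏ i ∈ s, f i := by
  classical
  induction s using Finset.induction_on with
  | empty => simp
  | insert a s ha ih =>
    rw [Finset.prod_insert ha, Finset.sum_insert ha, Derivation.leibniz,
      ih fun i hi => h i (Finset.mem_insert_of_mem hi), h a (Finset.mem_insert_self a s)]
    simp only [smul_eq_mul]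
    ring

lemma sum_sum_eq_diag_add {ι M : Type*} [Fintype ι] [LinearOrder ι] [LocallyFiniteOrderTop ι]
    [AddCommMonoid M] (f : ι → ι → M) :
    ∑ a, ∑ b, f a b = ∑ a, f a a + ∑ a, ∑ b ∈ Finset.Ioi a, (f a b + f b a) := by
  have h1 : ∀ a b, f a b = (if a = b then f a b else 0) + ((if a < b then f a b else 0) +
      (if b < a then f a b else 0)) := by
    intro a b
    rcases lt_trichotomy a b with h | h | h
    · simp [h, h.ne, h.not_gt]
    · simp [h]
    · simp [h, h.ne', h.not_gt]
  have h2 : ∀ (a : ι) (g : ι → M), ∑ b ∈ Finset.Ioi a, g b = ∑ b, if a < b then g b else 0 := by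
    intro a g
    rw [← Finset.sum_filter]
    congr 1; ext; simp
  conv_lhs => enter [2, a, 2, b]; rw [h1]
  simp only [Finset.sum_add_distrib, h2]
  congr 1
  · simp
  · conv_lhs => enter [2]; rw [Finset.sum_comm]
    simp only [← Finset.sum_add_distrib]
    refine Finset.sum_congr rfl fun a _ => Finset.sum_congr rfl fun b _ => ?_
    split_ifs <;> simp

variable {m : ℕ}

/-- `z_a² + z_a⁻²`. -/
def cz (a : Fin m) : Laurent m := zp a 2 + zp a (-2)

/-- The Weyl weight in the variable `z_a`. -/
def weylWeight (t : WeylType) (a : Fin m) : Laurent m :=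
  zp a t.e + (t.κ : Laurent m) * zp a (-t.e)

/-- The Weyl denominator. -/
def weyl (t : WeylType) (m : ℕ) : Laurent m :=
  (Matrix.vandermonde (cz (m := m))).det * ∏ a, weylWeight t a

/-- Power sum of all eigenvalues, including the fixed ones. -/
def fullSum (t : WeylType) (m : ℕ) (k : ℕ) : Laurent m := powSum m k + (t.s k : Laurent m)

/-- The derivation `∑ (z_a^(2k) - z_a^(-2k)) z_a ∂/∂z_a`. -/
def radial (m k : ℕ) : Derivation ℂ (Laurent m) (Laurent m) :=
  ∑ a, (zp a (2 * k) - zp a (-(2 * k))) • euler a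

lemma radial_apply (k : ℕ) (g : Laurent m) :
    radial m k g = ∑ a, (zp a (2 * k) - zp a (-(2 * k))) * euler a g := by
  have h := congrFun (map_sum (Derivation.coeFnAddMonoidHom (R := ℂ) (A := Laurent m)
    (M := Laurent m)) (fun a : Fin m => (zp a (2 * k) - zp a (-(2 * k))) • euler a)
    Finset.univ) g
  rw [Finset.sum_apply] at h
  exact h

lemma radial_zp (k : ℕ) (a : Fin m) (n : ℤ) :
    radial m k (zp a n) = (zp a (2 * k) - zp a (-(2 * k))) * (n * zp a n) := by
  simp [radial_apply, euler_zp]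

lemma zp_one_mul (a : Fin m) : zp a 1 * zp a (-1) = 1 := by simp [zp_mul]

lemma zp_nat (a : Fin m) (n : ℕ) : zp a n = zp a 1 ^ n := by rw [zp_pow]; simp

lemma zp_neg_nat (a : Fin m) (n : ℕ) : zp a (-n) = zp a (-1) ^ n := by rw [zp_pow]; simp

lemma zp_two_mul (a : Fin m) (k : ℕ) : zp a (2 * k) = zp a 2 ^ k := by
  rw [zp_pow]; congr 1; ring

lemma zp_neg_two_mul (a : Fin m) (k : ℕ) : zp a (-(2 * k)) = zp a (-2) ^ k := by
  rw [zp_pow]; congr 1; ring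

lemma zp_two_mul_neg (a : Fin m) : zp a 2 * zp a (-2) = 1 := by simp [zp_mul]

lemma radial_cz (k : ℕ) (a : Fin m) :
    radial m k (cz a) = 2 * ((zp a 2 ^ k - zp a (-2) ^ k) * (zp a 2 - zp a (-2))) := by
  rw [cz, map_add, radial_zp, radial_zp, zp_two_mul, zp_neg_two_mul]
  push_cast
  ring

lemma radial_weylWeight (t : WeylType) (k : ℕ) (a : Fin m) :
    radial m k (weylWeight t a) =
      (t.α * fixedSum (zp a 2) (zp a (-2)) 1 k + t.β * fixedSum (zp a 2) (zp a (-2)) (-1) k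
        + (1 - t.η) * selfSum (zp a 2) (zp a (-2)) k) * weylWeight t a := by
  have h := t.weight_identity (zp_one_mul a) k
  have e1 : zp a 1 ^ 2 = zp a 2 := by rw [zp_pow]; congr 1
  have e2 : zp a (-1) ^ 2 = zp a (-2) := by rw [zp_pow]; congr 1
  rw [e1, e2] at h
  rw [weylWeight, zp_nat, zp_neg_nat, ← h, map_add, ← zp_nat, ← zp_neg_nat]
  have h3 : radial m k ((t.κ : Laurent m) * zp a (-t.e)) =
      t.κ * radial m k (zp a (-t.e)) := by
    rw [Derivation.leibniz, Derivation.map_intCast]; simp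
  rw [h3, radial_zp, radial_zp, zp_two_mul, zp_neg_two_mul]
  push_cast
  ring

lemma radial_weyl (t : WeylType) (k : ℕ) :
    radial m k (weyl t m) =
      ((∑ a, ∑ b ∈ Finset.Ioi a, crossSum (zp b 2) (zp b (-2)) (zp a 2) (zp a (-2)) k) +
        ∑ a, (t.α * fixedSum (zp a 2) (zp a (-2)) 1 k + t.β * fixedSum (zp a 2) (zp a (-2)) (-1) k
        + (1 - t.η) * selfSum (zp a 2) (zp a (-2)) k)) * weyl t m := by
  have h1 : radial m k (∏ a, weylWeight t a) = _ :=
    derivation_prod_of_log (radial m k) Finset.univ (weylWeight t) _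
      fun a _ => radial_weylWeight t k a
  have h2 : radial m k (Matrix.vandermonde (cz (m := m))).det =
      (∑ a, ∑ b ∈ Finset.Ioi a, crossSum (zp b 2) (zp b (-2)) (zp a 2) (zp a (-2)) k) *
        (Matrix.vandermonde (cz (m := m))).det := by
    rw [Matrix.det_vandermonde]
    refine derivation_prod_of_log (radial m k) Finset.univ _
      (fun a => ∑ b ∈ Finset.Ioi a, crossSum (zp b 2) (zp b (-2)) (zp a 2) (zp a (-2)) k)
      fun a _ => ?_
    refine derivation_prod_of_log (radial m k) (Finset.Ioi a) _ _ fun b _ => ?_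
    rw [map_sub, radial_cz, radial_cz, cz, cz, crossSum_mul (zp_two_mul_neg b) (zp_two_mul_neg a)]
  rw [weyl, Derivation.leibniz, h1, h2]
  simp only [smul_eq_mul]
  ring

lemma zp_sub (a : Fin m) {k i : ℕ} (hi : i ≤ k) :
    zp a (2 * (k - 2 * i : ℤ)) = zp a 2 ^ (k - i) * zp a (-2) ^ i := by
  rw [zp_pow, zp_pow, zp_mul]
  congr 1
  push_cast [hi]
  ring

lemma powSum_eq (k : ℕ) : powSum m k = ∑ a, (zp a 2 ^ k + zp a (-2) ^ k) := by
  simp only [powSum, zp_two_mul, zp_neg_two_mul]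

lemma powSum_natAbs {k i : ℕ} (hi : i ≤ k) :
    powSum m (k - 2 * i : ℤ).natAbs =
      ∑ a, (zp a 2 ^ (k - i) * zp a (-2) ^ i + zp a (-2) ^ (k - i) * zp a 2 ^ i) := by
  refine Finset.sum_congr rfl fun a _ => ?_
  have h1 := zp_sub a hi
  have h2 : zp a (-(2 * (k - 2 * i : ℤ))) = zp a (-2) ^ (k - i) * zp a 2 ^ i := by
    rw [zp_pow, zp_pow, zp_mul]
    congr 1
    push_cast [hi]
    ring
  rw [← h1, ← h2]
  rcases Int.natAbs_eq (k - 2 * i : ℤ) with h | h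
  · rw [← h]
  · have h' : (((k - 2 * i : ℤ).natAbs : ℕ) : ℤ) = -(k - 2 * i) := by omega
    rw [h', add_comm]; congr 2 <;> ring

lemma sum_powSum_mul (k : ℕ) :
    ∑ i ∈ Finset.range k, powSum m i * powSum m (k - i) =
      (k : Laurent m) * powSum m k + ∑ a, selfSum (zp a 2) (zp a (-2)) k +
      ∑ a, ∑ b ∈ Finset.Ioi a, crossSum (zp b 2) (zp b (-2)) (zp a 2) (zp a (-2)) k := by
  simp only [powSum_eq, Finset.sum_mul_sum]
  rw [Finset.sum_comm]
  conv_lhs => enter [2, a]; rw [Finset.sum_comm]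
  rw [sum_sum_eq_diag_add]
  congr 1
  · rw [Finset.mul_sum, ← Finset.sum_add_distrib]
    refine Finset.sum_congr rfl fun a _ => ?_
    have : (k : Laurent m) * (zp a 2 ^ k + zp a (-2) ^ k) =
        ∑ i ∈ Finset.range k, (zp a 2 ^ k + zp a (-2) ^ k) := by
      rw [Finset.sum_const, Finset.card_range, nsmul_eq_mul]
    rw [this, selfSum, ← Finset.sum_add_distrib]
    refine Finset.sum_congr rfl fun i hi => ?_
    rw [Finset.mem_range] at hi
    have h1 : zp a 2 ^ k = zp a 2 ^ i * zp a 2 ^ (k - i) := by rw [← pow_add]; congr 1; omega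
    have h2 : zp a (-2) ^ k = zp a (-2) ^ i * zp a (-2) ^ (k - i) := by
      rw [← pow_add]; congr 1; omega
    rw [h1, h2]; ring
  · refine Finset.sum_congr rfl fun a _ => Finset.sum_congr rfl fun b _ => ?_
    rw [crossSum, ← Finset.sum_add_distrib]
    exact Finset.sum_congr rfl fun i _ => by ring

lemma sum_fullSum_mul (t : WeylType) (k : ℕ) :
    ∑ i ∈ Finset.range k, (fullSum t m i * fullSum t m (k - i) -
        (t.η : Laurent m) * fullSum t m (k - 2 * i : ℤ).natAbs) =
      (k : Laurent m) * powSum m k +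
      ((∑ a, ∑ b ∈ Finset.Ioi a, crossSum (zp b 2) (zp b (-2)) (zp a 2) (zp a (-2)) k) +
        ∑ a, (t.α * fixedSum (zp a 2) (zp a (-2)) 1 k + t.β * fixedSum (zp a 2) (zp a (-2)) (-1) k
        + (1 - t.η) * selfSum (zp a 2) (zp a (-2)) k)) := by
  have h0 : ∑ i ∈ Finset.range k, ((t.s i : Laurent m) * t.s (k - i) -
      t.η * t.s (k - 2 * i : ℤ).natAbs) = 0 := by
    exact_mod_cast congrArg (Int.cast : ℤ → Laurent m) (t.s_sum k)
  have h1 : ∑ i ∈ Finset.range k, powSum m (k - 2 * i : ℤ).natAbs =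
      ∑ a, selfSum (zp a 2) (zp a (-2)) k := by
    rw [Finset.sum_congr rfl fun i hi => powSum_natAbs (Finset.mem_range.1 hi).le,
      Finset.sum_comm]
    rfl
  have h2 : ∑ i ∈ Finset.range k, ((t.s i : Laurent m) * powSum m (k - i) +
      t.s (k - i) * powSum m i) = ∑ a, (t.α * fixedSum (zp a 2) (zp a (-2)) 1 k +
        t.β * fixedSum (zp a 2) (zp a (-2)) (-1) k) := by
    simp only [powSum_eq, Finset.mul_sum, ← Finset.sum_add_distrib, fixedSum]
    rw [Finset.sum_comm]
    refine Finset.sum_congr rfl fun a _ => Finset.sum_congr rfl fun i _ => ?_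
    simp only [WeylType.s]
    push_cast
    ring
  have h3 : ∀ i, fullSum t m i * fullSum t m (k - i) -
        (t.η : Laurent m) * fullSum t m (k - 2 * i : ℤ).natAbs =
      powSum m i * powSum m (k - i) + ((t.s i : Laurent m) * powSum m (k - i) +
      t.s (k - i) * powSum m i) + ((t.s i : Laurent m) * t.s (k - i) -
      t.η * t.s (k - 2 * i : ℤ).natAbs) - t.η * powSum m (k - 2 * i : ℤ).natAbs := by
    intro i
    simp only [fullSum]
    ring
  simp only [h3, Finset.sum_add_distrib, Finset.sum_sub_distrib] at h0 h2 ⊢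
  simp only [← Finset.mul_sum] at h0 h2 ⊢
  rw [sum_powSum_mul, h2, h1]
  linear_combination h0

lemma euler_fullSum (t : WeylType) (a : Fin m) (k : ℕ) :
    euler a (fullSum t m k) = 2 * k * (zp a (2 * k) - zp a (-(2 * k))) := by
  rw [fullSum, map_add, Derivation.map_intCast, add_zero, euler_powSum]

lemma lap_fullSum (t : WeylType) (k : ℕ) : lap (fullSum t m k) = 4 * k ^ 2 * powSum m k := by
  rw [← lap_powSum, lap_eq, lap_eq]
  simp only [fullSum, map_add, Derivation.map_intCast, add_zero]

/-- The radial part of the Laplacian on power sums. -/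
lemma lap_fullSum_mul_weyl (t : WeylType) (k : ℕ) :
    lap (fullSum t m k) * weyl t m + 2 * torusGrad (fullSum t m k) (weyl t m) =
      4 * k * (∑ i ∈ Finset.range k, (fullSum t m i * fullSum t m (k - i) -
        (t.η : Laurent m) * fullSum t m (k - 2 * i : ℤ).natAbs)) * weyl t m := by
  have h : torusGrad (fullSum t m k) (weyl t m) = 2 * k * radial m k (weyl t m) := by
    simp only [torusGrad, euler_fullSum, radial_apply, Finset.mul_sum, mul_assoc]
  rw [h, radial_weyl, sum_fullSum_mul, lap_fullSum]
  ring

lemma torusGrad_fullSum (t : WeylType) (k l : ℕ) :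
    torusGrad (fullSum t m k) (fullSum t m l) =
      4 * k * l * (fullSum t m (k + l) - fullSum t m (k - l : ℤ).natAbs) := by
  have : torusGrad (fullSum t m k) (fullSum t m l) = torusGrad (powSum m k) (powSum m l) := by
    simp only [torusGrad, euler_fullSum, euler_powSum]
  rw [this, torusGrad_powSum]
  simp only [fullSum, t.s_add]
  ring

end

section

variable {m : ℕ}

/-- Permutation of the exponents. -/
def permEquiv (σ : Equiv.Perm (Fin m)) : (Fin m → ℤ) ≃+ (Fin m → ℤ) where
  toFun v := v ∘ σ
  invFun v := v ∘ σ.symm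
  left_inv v := by ext; simp
  right_inv v := by ext; simp
  map_add' v w := rfl

/-- Negation of one exponent. -/
def flipEquiv (a : Fin m) : (Fin m → ℤ) ≃+ (Fin m → ℤ) where
  toFun v := Function.update v a (-v a)
  invFun v := Function.update v a (-v a)
  left_inv v := by simp
  right_inv v := by simp
  map_add' v w := by
    ext b
    by_cases h : b = a
    · subst h; simp; ring
    · simp [h]

lemma permEquiv_single (σ : Equiv.Perm (Fin m)) (a : Fin m) (n : ℤ) :
    permEquiv σ (Pi.single a n) = Pi.single (σ.symm a) n := by
  ext b
  simp [permEquiv, Pi.single_apply, Equiv.eq_symm_apply]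

lemma flipEquiv_single (a b : Fin m) (n : ℤ) :
    flipEquiv a (Pi.single b n) = Pi.single b (if a = b then -n else n) := by
  ext c
  by_cases h : a = b
  · subst h
    by_cases hc : c = a
    · subst hc; simp [flipEquiv]
    · simp [flipEquiv, hc]
  · by_cases hc : c = a
    · subst hc; simp [flipEquiv, h]
    · simp [flipEquiv, hc, h]

/-- The automorphism of Laurent polynomials permuting the variables. -/
def permHom (σ : Equiv.Perm (Fin m)) : Laurent m →ₐ[ℂ] Laurent m :=
  (AddMonoidAlgebra.domCongr ℂ ℂ (permEquiv σ)).toAlgHom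

/-- The automorphism of Laurent polynomials inverting one variable. -/
def flipHom (a : Fin m) : Laurent m →ₐ[ℂ] Laurent m :=
  (AddMonoidAlgebra.domCongr ℂ ℂ (flipEquiv a)).toAlgHom

/-- The automorphism of Laurent polynomials negating one variable. -/
def negHom (a : Fin m) : Laurent m →ₐ[ℂ] Laurent m :=
  AddMonoidAlgebra.lift ℂ (Laurent m) (Fin m → ℤ)
    { toFun := fun v => AddMonoidAlgebra.single v.toAdd ((-1) ^ (v.toAdd a))
      map_one' := by simp [AddMonoidAlgebra.one_def]
      map_mul' := fun v w => by
        simp [AddMonoidAlgebra.single_mul_single, zpow_add₀] }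

lemma permHom_zp (σ : Equiv.Perm (Fin m)) (a : Fin m) (n : ℤ) :
    permHom σ (zp a n) = zp (σ.symm a) n := by
  simp only [permHom, zp]
  exact (AddMonoidAlgebra.domCongr_single _ _ _).trans (by rw [permEquiv_single])

lemma flipHom_zp (a b : Fin m) (n : ℤ) :
    flipHom a (zp b n) = zp b (if a = b then -n else n) := by
  simp only [flipHom, zp]
  exact (AddMonoidAlgebra.domCongr_single _ _ _).trans (by rw [flipEquiv_single])

lemma negHom_zp (a b : Fin m) (n : ℤ) :
    negHom a (zp b n) = (if a = b then (((-1) ^ n : ℤˣ) : ℤ) else 1 : ℤ) * zp b n := by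
  simp only [negHom, zp, AddMonoidAlgebra.lift_single]
  by_cases h : a = b
  · subst h
    rcases Int.even_or_odd n with hn | hn
    · simp [hn.neg_one_zpow]
    · simp [hn.neg_one_zpow, AddMonoidAlgebra.single_neg]
  · simp [h]

lemma coeff_permHom (σ : Equiv.Perm (Fin m)) (g : Laurent m) (v : Fin m → ℤ) :
    (permHom σ g).coeff v = g.coeff (v ∘ σ.symm) :=
  AddMonoidAlgebra.coeff_domCongr _ _ _

lemma coeff_flipHom (a : Fin m) (g : Laurent m) (v : Fin m → ℤ) :
    (flipHom a g).coeff v = g.coeff (Function.update v a (-v a)) :=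
  AddMonoidAlgebra.coeff_domCongr _ _ _

lemma coeff_negHom (a : Fin m) (g : Laurent m) (v : Fin m → ℤ) :
    (negHom a g).coeff v = (-1) ^ (v a) * g.coeff v := by
  induction g using AddMonoidAlgebra.induction_linear with
  | zero => simp
  | add g h hg hh => simp [hg, hh, mul_add]
  | single w c =>
    simp only [negHom, AddMonoidAlgebra.lift_single]
    by_cases h : w = v
    · subst h; simp [mul_comm]
    · simp [h]

/-- Evaluation of polynomials in the symbols `t_k` at the power sums on the torus. -/
def torusEval (t : WeylType) (m : ℕ) : MvPolynomial ℕ ℂ →ₐ[ℂ] Laurent m :=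
  MvPolynomial.aeval (fullSum t m)

lemma map_torusEval (t : WeylType) (F : Laurent m →ₐ[ℂ] Laurent m)
    (h : ∀ k, F (powSum m k) = powSum m k) (f : MvPolynomial ℕ ℂ) :
    F (torusEval t m f) = torusEval t m f := by
  have : F.comp (torusEval t m) = torusEval t m := by
    ext k
    simp [torusEval, fullSum, h]
  exact AlgHom.congr_fun this f

lemma permHom_powSum (σ : Equiv.Perm (Fin m)) (k : ℕ) :
    permHom σ (powSum m k) = powSum m k := by
  simp only [powSum, map_sum, map_add, permHom_zp]
  exact Equiv.sum_comp σ.symm fun a => zp a (2 * k) + zp a (-(2 * k))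

lemma flipHom_powSum (a : Fin m) (k : ℕ) : flipHom a (powSum m k) = powSum m k := by
  simp only [powSum, map_sum, map_add, flipHom_zp]
  refine Finset.sum_congr rfl fun b _ => ?_
  split_ifs
  · rw [neg_neg, add_comm]
  · rfl

lemma negHom_powSum (a : Fin m) (k : ℕ) : negHom a (powSum m k) = powSum m k := by
  simp only [powSum, map_sum, map_add, negHom_zp]
  refine Finset.sum_congr rfl fun b _ => ?_
  have h1 : ((-1 : ℤˣ)) ^ (2 * k : ℤ) = 1 := Even.neg_one_zpow (by simp)
  have h2 : ((-1 : ℤˣ)) ^ (-(2 * k) : ℤ) = 1 := Even.neg_one_zpow (by simp)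
  simp [h1, h2]

lemma permHom_weyl (t : WeylType) (σ : Equiv.Perm (Fin m)) :
    permHom σ (weyl t m) = (Equiv.Perm.sign σ : ℤ) * weyl t m := by
  have h1 : permHom σ (Matrix.vandermonde (cz (m := m))).det =
      (Equiv.Perm.sign σ : ℤ) * (Matrix.vandermonde (cz (m := m))).det := by
    rw [AlgHom.map_det, ← Equiv.Perm.sign_inv, ← Matrix.det_permute]
    congr 1
    ext i j : 2
    simp [Matrix.vandermonde_apply, cz, permHom_zp]
  have h2 : permHom σ (∏ a, weylWeight t a) = ∏ a, weylWeight t a := by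
    simp only [map_prod, weylWeight, map_add, map_mul, permHom_zp, map_intCast]
    exact Equiv.prod_comp σ.symm fun a => zp a t.e + (t.κ : Laurent m) * zp a (-t.e)
  rw [weyl, map_mul, h1, h2, mul_assoc]

lemma WeylType.κ_mul_self (t : WeylType) : t.κ * t.κ = 1 := by cases t <;> simp [WeylType.κ]

lemma flipHom_weyl (t : WeylType) (a : Fin m) :
    flipHom a (weyl t m) = t.κ * weyl t m := by
  have h1 : flipHom a (Matrix.vandermonde (cz (m := m))).det =
      (Matrix.vandermonde (cz (m := m))).det := by
    rw [AlgHom.map_det]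
    congr 1
    ext i j : 2
    simp only [AlgHom.mapMatrix_apply, Matrix.map_apply, Matrix.vandermonde_apply, cz, map_pow,
      map_add, flipHom_zp]
    split_ifs
    · rw [neg_neg, add_comm]
    · rfl
  have h2 : ∀ b, flipHom a (weylWeight t b) =
      (if a = b then (t.κ : Laurent m) else 1) * weylWeight t b := by
    intro b
    simp only [map_add, weylWeight, map_mul, flipHom_zp, map_intCast]
    split_ifs
    · have : (t.κ : Laurent m) * t.κ = 1 := by rw [← Int.cast_mul, t.κ_mul_self, Int.cast_one]
      rw [neg_neg]
      linear_combination (-zp b (-(t.e : ℤ))) * this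
    · ring
  rw [weyl, map_mul, h1, map_prod, Finset.prod_congr rfl fun b _ => h2 b, Finset.prod_mul_distrib,
    Finset.prod_ite_eq Finset.univ a fun _ => (t.κ : Laurent m), if_pos (Finset.mem_univ a)]
  ring

lemma negHom_weyl (t : WeylType) (a : Fin m) :
    negHom a (weyl t m) = (((-1) ^ t.e : ℤ) : Laurent m) * weyl t m := by
  have h1 : negHom a (Matrix.vandermonde (cz (m := m))).det =
      (Matrix.vandermonde (cz (m := m))).det := by
    rw [AlgHom.map_det]
    congr 1
    ext i j : 2
    have e1 : ((-1 : ℤˣ)) ^ (2 : ℤ) = 1 := by decide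
    have e2 : ((-1 : ℤˣ)) ^ (-2 : ℤ) = 1 := by decide
    simp [AlgHom.mapMatrix_apply, Matrix.map_apply, Matrix.vandermonde_apply, cz, negHom_zp, e1,
      e2]
  have h2 : ∀ b, negHom a (weylWeight t b) =
      (if a = b then (((-1) ^ t.e : ℤ) : Laurent m) else 1) * weylWeight t b := by
    intro b
    simp only [map_add, weylWeight, map_mul, negHom_zp, map_intCast]
    split_ifs
    · simp; ring
    · simp
  rw [weyl, map_mul, h1, map_prod, Finset.prod_congr rfl fun b _ => h2 b, Finset.prod_mul_distrib,
    Finset.prod_ite_eq Finset.univ a fun _ => (((-1) ^ t.e : ℤ) : Laurent m),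
    if_pos (Finset.mem_univ a)]
  ring

/-- Laurent polynomials transforming like the Weyl denominator. -/
structure Alternating (t : WeylType) (g : Laurent m) : Prop where
  perm : ∀ (σ : Equiv.Perm (Fin m)) (v : Fin m → ℤ),
    g.coeff (v ∘ σ) = (Equiv.Perm.sign σ : ℤ) * g.coeff v
  flip : ∀ (a : Fin m) (v : Fin m → ℤ), g.coeff (Function.update v a (-v a)) = t.κ * g.coeff v
  parity : ∀ (v : Fin m → ℤ), g.coeff v ≠ 0 → ∀ a, Even (v a - t.e)

lemma intCast_mul_coeff (n : ℤ) (g : Laurent m) (v : Fin m → ℤ) :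
    ((n : Laurent m) * g).coeff v = n * g.coeff v := by
  rw [← zsmul_eq_mul, ← zsmul_eq_mul]
  rfl

lemma alternating_torusEval (t : WeylType) (f : MvPolynomial ℕ ℂ) :
    Alternating t (torusEval t m f * weyl t m) where
  perm σ v := by
    have h : permHom σ⁻¹ (torusEval t m f * weyl t m) =
        (Equiv.Perm.sign σ : ℤ) * (torusEval t m f * weyl t m) := by
      rw [map_mul, map_torusEval t _ (permHom_powSum _), permHom_weyl, Equiv.Perm.sign_inv]
      ring
    have h' := congrArg (fun g : Laurent m => g.coeff v) h
    simp only [intCast_mul_coeff] at h'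
    rw [← h', coeff_permHom]
    rfl
  flip a v := by
    have h : flipHom a (torusEval t m f * weyl t m) =
        t.κ * (torusEval t m f * weyl t m) := by
      rw [map_mul, map_torusEval t _ (flipHom_powSum _), flipHom_weyl]
      ring
    have h' := congrArg (fun g : Laurent m => g.coeff v) h
    simp only [intCast_mul_coeff] at h'
    rw [← h', coeff_flipHom]
  parity v hv a := by
    have h : negHom a (torusEval t m f * weyl t m) =
        (((-1) ^ t.e : ℤ) : Laurent m) * (torusEval t m f * weyl t m) := by
      rw [map_mul, map_torusEval t _ (negHom_powSum _), negHom_weyl]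
      ring
    have h' := congrArg (fun g : Laurent m => g.coeff v) h
    simp only [intCast_mul_coeff] at h'
    rw [coeff_negHom] at h'
    have h2 := mul_right_cancel₀ hv h'
    by_contra hodd
    rw [Int.not_even_iff_odd] at hodd
    have h3 : v a = t.e + (v a - t.e) := by ring
    rw [h3, zpow_add₀ (by norm_num), hodd.neg_one_zpow, zpow_natCast] at h2
    push_cast at h2
    have h4 : ((-1 : ℂ)) ^ t.e ≠ 0 := by simp
    have : (2 : ℂ) * (-1) ^ t.e = 0 := by linear_combination -h2
    simp at this

lemma alternating_weyl (t : WeylType) : Alternating t (weyl t m) := by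
  simpa using alternating_torusEval t (m := m) 1

namespace Alternating

variable {t : WeylType} {g : Laurent m}

lemma ne_of_coeff_ne_zero (hg : Alternating t g) {v : Fin m → ℤ} (hv : g.coeff v ≠ 0)
    {a b : Fin m} (hab : a ≠ b) : v a ≠ v b := by
  intro h
  apply hv
  have h1 := hg.perm (Equiv.swap a b) v
  have h2 : v ∘ Equiv.swap a b = v := by
    ext c
    simp only [Function.comp_apply, Equiv.swap_apply_def]
    split_ifs with h3 h4
    · rw [h3, h]
    · rw [h4, h]
    · rfl
  rw [h2, Equiv.Perm.sign_swap hab] at h1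
  push_cast at h1
  have : 2 * g.coeff v = 0 := by linear_combination h1
  simpa using this

lemma natAbs_injective (hg : Alternating t g) {v : Fin m → ℤ} (hv : g.coeff v ≠ 0) :
    Function.Injective fun a => (v a).natAbs := by
  intro a b hab
  by_contra hne
  rcases Int.natAbs_eq_natAbs_iff.1 hab with h | h
  · exact hg.ne_of_coeff_ne_zero hv hne h
  · have h1 := hg.flip a v
    have h2 : g.coeff (Function.update v a (-v a)) ≠ 0 := by
      rw [h1]
      refine mul_ne_zero ?_ hv
      cases t <;> simp [WeylType.κ]
    refine hg.ne_of_coeff_ne_zero h2 hne ?_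
    simp [Ne.symm hne, h]

/-- On the support, `|v_a| = 2 h + e`. -/
lemma exists_natAbs_eq (hg : Alternating t g) {v : Fin m → ℤ} (hv : g.coeff v ≠ 0) (a : Fin m) :
    ∃ h : ℕ, (v a).natAbs = 2 * h + t.e := by
  have h1 := hg.parity v hv a
  by_cases h0 : v a = 0
  · have h2 := hg.flip a v
    rw [h0, neg_zero, ← h0, Function.update_eq_self] at h2
    have h3 : t.κ = 1 := by
      have : ((t.κ : ℂ) - 1) * g.coeff v = 0 := by linear_combination -h2
      rcases mul_eq_zero.1 this with h | h
      · exact_mod_cast sub_eq_zero.1 h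
      · exact absurd h hv
    rw [h0] at h1
    cases t
    · exact ⟨0, by simp [h0, WeylType.e]⟩
    · simp [WeylType.κ] at h3
    · simp [WeylType.e] at h1
    · simp [WeylType.κ] at h3
    · simp [WeylType.κ] at h3
  · refine ⟨((v a).natAbs - t.e) / 2, ?_⟩
    obtain ⟨r, hr⟩ := h1
    have : t.e ≤ 2 := by cases t <;> simp [WeylType.e]
    omega

lemma norm_coeff_flip (hg : Alternating t g) (s : Finset (Fin m)) (v : Fin m → ℤ) :
    ‖g.coeff fun a => if a ∈ s then -v a else v a‖ = ‖g.coeff v‖ := by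
  induction s using Finset.induction_on with
  | empty => simp
  | insert b s hb ih =>
    rw [← ih]
    have h := hg.flip b fun a => if a ∈ s then -v a else v a
    have h2 : Function.update (fun a => if a ∈ s then -v a else v a) b
        (-(if b ∈ s then -v b else v b)) = fun a => if a ∈ insert b s then -v a else v a := by
      ext a
      by_cases hab : a = b
      · subst hab; simp [hb]
      · simp [hab]
    rw [h2] at h
    rw [h, norm_mul]
    have : ‖(t.κ : ℂ)‖ = 1 := by cases t <;> simp [WeylType.κ]
    rw [this, one_mul]

lemma norm_coeff_perm (hg : Alternating t g) (σ : Equiv.Perm (Fin m)) (v : Fin m → ℤ) :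
    ‖g.coeff (v ∘ σ)‖ = ‖g.coeff v‖ := by
  rw [hg.perm, norm_mul]
  rcases Int.units_eq_one_or (Equiv.Perm.sign σ) with h | h <;> simp [h]

lemma norm_coeff_eq (hg : Alternating t g) {v w : Fin m → ℤ} (σ : Equiv.Perm (Fin m))
    (h : ∀ a, (v a).natAbs = (w (σ a)).natAbs) : ‖g.coeff v‖ = ‖g.coeff w‖ := by
  classical
  rw [← hg.norm_coeff_perm σ w,
    ← hg.norm_coeff_flip (Finset.univ.filter fun a => v a ≠ w (σ a)) (w ∘ σ)]
  congr 2
  ext a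
  simp only [Finset.mem_filter, Finset.mem_univ, true_and, Function.comp_apply]
  split_ifs with h1
  · exact (Int.natAbs_eq_natAbs_iff.1 (h a)).resolve_left h1
  · exact not_not.1 h1

end Alternating

/-- The leading exponent of the Weyl denominator. -/
def rho (t : WeylType) (m : ℕ) : Fin m → ℤ := fun a => 2 * (a : ℕ) + t.e

/-- The Laplace eigenvalue of the Weyl denominator. -/
def rhoSq (t : WeylType) (m : ℕ) : ℕ := ∑ a : Fin m, (2 * (a : ℕ) + t.e) ^ 2

/-- The exponents of `z_a` in `g` are at most `d` in absolute value. -/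
def DegLE (a : Fin m) (d : ℕ) (g : Laurent m) : Prop := ∀ v, g.coeff v ≠ 0 → (v a).natAbs ≤ d

namespace DegLE

variable {a : Fin m} {d d' : ℕ} {g h : Laurent m}

lemma mono (hg : DegLE a d g) (hd : d ≤ d') : DegLE a d' g := fun v hv => (hg v hv).trans hd

lemma add (hg : DegLE a d g) (hh : DegLE a d h) : DegLE a d (g + h) := by
  intro v hv
  by_cases h1 : g.coeff v = 0
  · refine hh v fun h2 => hv ?_
    simp [h1, h2]
  · exact hg v h1

lemma sum {ι : Type*} (s : Finset ι) (f : ι → Laurent m) (hf : ∀ i ∈ s, DegLE a d (f i)) :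
    DegLE a d (∑ i ∈ s, f i) := by
  classical
  induction s using Finset.induction_on with
  | empty => intro v hv; simp at hv
  | insert b s hb ih =>
    rw [Finset.sum_insert hb]
    exact (hf b (Finset.mem_insert_self b s)).add
      (ih fun i hi => hf i (Finset.mem_insert_of_mem hi))

lemma mul (hg : DegLE a d g) (hh : DegLE a d' h) : DegLE a (d + d') (g * h) := by
  classical
  intro v hv
  have h1 := AddMonoidAlgebra.support_coeff_mul_subset g h (Finsupp.mem_support_iff.2 hv)
  obtain ⟨x, hx, y, hy, rfl⟩ := Finset.mem_add.1 h1
  have h2 := hg x (Finsupp.mem_support_iff.1 hx)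
  have h3 := hh y (Finsupp.mem_support_iff.1 hy)
  simp only [Pi.add_apply]
  omega

lemma single (v : Fin m → ℤ) (c : ℂ) : DegLE a (v a).natAbs (AddMonoidAlgebra.single v c) := by
  intro w hw
  by_cases h : v = w
  · rw [h]
  · simp [h] at hw

lemma one : DegLE a 0 (1 : Laurent m) := by
  simpa [AddMonoidAlgebra.one_def] using single (a := a) (0 : Fin m → ℤ) 1

lemma intCast (n : ℤ) : DegLE a 0 (n : Laurent m) := by
  simpa [AddMonoidAlgebra.intCast_def] using single (a := a) (0 : Fin m → ℤ) n

lemma pow (hg : DegLE a d g) (k : ℕ) : DegLE a (k * d) (g ^ k) := by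
  induction k with
  | zero => simpa using one
  | succ k ih => rw [pow_succ, add_mul, one_mul]; exact ih.mul hg

lemma prod {ι : Type*} (s : Finset ι) (f : ι → Laurent m) (d : ι → ℕ)
    (hf : ∀ i ∈ s, DegLE a (d i) (f i)) : DegLE a (∑ i ∈ s, d i) (∏ i ∈ s, f i) := by
  classical
  induction s using Finset.induction_on with
  | empty => simpa using one
  | insert b s hb ih =>
    rw [Finset.sum_insert hb, Finset.prod_insert hb]
    exact (hf b (Finset.mem_insert_self b s)).mul
      (ih fun i hi => hf i (Finset.mem_insert_of_mem hi))

lemma zp (b : Fin m) (n : ℤ) : DegLE a (if b = a then n.natAbs else 0) (zp b n) := by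
  refine (single (a := a) (Pi.single b n) 1).mono ?_
  by_cases h : b = a
  · subst h; simp
  · simp [h, Ne.symm h]

lemma cz (b : Fin m) : DegLE a (if b = a then 2 else 0) (cz b) :=
  (zp (a := a) b 2).add (zp (a := a) b (-2))

end DegLE

lemma degLE_weyl (t : WeylType) (a : Fin m) : DegLE a (2 * (m - 1) + t.e) (weyl t m) := by
  refine DegLE.mul ?_ ?_
  · rw [Matrix.det_apply']
    refine DegLE.sum _ _ fun σ _ => ?_
    have h : DegLE a (∑ i, if σ i = a then (i : ℕ) * 2 else 0)
        (∏ i, Matrix.vandermonde (cz (m := m)) (σ i) i) := by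
      refine DegLE.prod _ _ _ fun i _ => ?_
      rw [Matrix.vandermonde_apply]
      refine (DegLE.pow (DegLE.cz (a := a) (σ i)) i).mono ?_
      split_ifs <;> simp
    refine ((DegLE.intCast (a := a) _).mul h).mono ?_
    have h2 : ∀ i, (if σ i = a then (i : ℕ) * 2 else 0) =
        if i = σ.symm a then ((σ.symm a : Fin m) : ℕ) * 2 else 0 := by
      intro i
      by_cases h : σ i = a
      · have : i = σ.symm a := by simp [← h]
        simp [h, ← this]
      · have : i ≠ σ.symm a := fun hi => h (by simp [hi])
        simp [h, this]
    simp only [h2, Finset.sum_ite_eq', Finset.mem_univ, if_true]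
    have := (σ.symm a).isLt
    omega
  · refine (DegLE.prod (a := a) Finset.univ (weylWeight t) (fun b => if b = a then t.e else 0)
      fun b _ => ?_).mono (by simp)
    refine DegLE.add ?_ ?_
    · simpa using DegLE.zp (a := a) b t.e
    · have := (DegLE.intCast (a := a) t.κ).mul (DegLE.zp (a := a) b (-t.e))
      simpa using this

lemma weyl_ne_zero (t : WeylType) (m : ℕ) : weyl t m ≠ 0 := by
  have hz : ∀ (a : Fin m) (n : ℤ) (v : Fin m → ℤ), (zp a n).coeff v =
      if Pi.single a n = v then 1 else 0 := by
    intro a n v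
    rw [zp, AddMonoidAlgebra.coeff_single, Finsupp.single_apply]
  refine mul_ne_zero ?_ (Finset.prod_ne_zero_iff.2 fun a _ h => ?_)
  · rw [Matrix.det_vandermonde_ne_zero_iff]
    intro a b hab
    by_contra hne
    have := congrArg (fun g : Laurent m => g.coeff (Pi.single a 2)) hab
    have h1 : (Pi.single a (-2) : Fin m → ℤ) ≠ Pi.single a 2 := fun h => by
      have := congrFun h a; simp at this
    have h2 : ∀ n : ℤ, (Pi.single b n : Fin m → ℤ) ≠ Pi.single a 2 := fun n h => by
      have := congrFun h a; simp [hne] at this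
    simp [cz, hz, h1, h2] at this
  · have := congrArg (fun g : Laurent m => g.coeff (Pi.single a (t.e : ℤ))) h
    simp only [weylWeight, AddMonoidAlgebra.coeff_add, Finsupp.add_apply, intCast_mul_coeff, hz,
      AddMonoidAlgebra.coeff_zero, Finsupp.zero_apply, if_true] at this
    have h1 : t.e ≠ 0 → (Pi.single a (-t.e : ℤ) : Fin m → ℤ) ≠ Pi.single a (t.e : ℤ) :=
      fun h0 h => by
        have := congrFun h a
        simp only [Pi.single_eq_same] at this
        omega
    cases t
    · simp [WeylType.e, WeylType.κ] at this
    all_goals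
      rw [if_neg (h1 (by simp [WeylType.e]))] at this
      simp at this

end

section

variable {m : ℕ}

lemma exists_perm_of_lt {h : Fin m → ℕ} (hinj : Function.Injective h) (hlt : ∀ i, h i < m) :
    ∃ σ : Equiv.Perm (Fin m), ∀ i, h i = σ i := by
  have hb : Function.Bijective (fun i => (⟨h i, hlt i⟩ : Fin m)) := by
    rw [← Finite.injective_iff_bijective]
    intro i j hij
    exact hinj (congrArg Fin.val hij)
  exact ⟨Equiv.ofBijective _ hb, fun i => rfl⟩

lemma exists_perm_of_sum_eq {h : Fin m → ℕ} (hinj : Function.Injective h) {F : ℕ → ℕ}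
    (hF : StrictMono F) (hsum : ∑ i, F (h i) = ∑ i : Fin m, F i) :
    ∃ σ : Equiv.Perm (Fin m), ∀ i, h i = σ i := by
  classical
  have hcard : (Finset.univ.image h).card = m := by
    rw [Finset.card_image_of_injective _ hinj, Finset.card_univ, Fintype.card_fin]
  let o := (Finset.univ.image h).orderEmbOfFin hcard
  have hle : ∀ i : Fin m, (i : ℕ) ≤ o i := by
    rintro ⟨i, hi⟩
    induction i with
    | zero => simp
    | succ i ih =>
      have h1 := ih (by omega)
      have h2 : o ⟨i, by omega⟩ < o ⟨i + 1, hi⟩ := o.strictMono (by simp)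
      simp only at h1 ⊢
      omega
  have hs : ∑ i, F (o i) = ∑ i : Fin m, F i := by
    rw [← hsum, ← Finset.sum_image (f := F) (s := Finset.univ) (g := h)
      (fun i _ j _ hij => hinj hij)]
    rw [← Finset.sum_image (f := F) (s := Finset.univ) (g := o)
      (fun i _ j _ hij => o.injective hij), Finset.image_orderEmbOfFin_univ]
  have heq : ∀ i : Fin m, (i : ℕ) = o i := fun i => by
    have := (Finset.sum_eq_sum_iff_of_le (s := Finset.univ) (f := fun i : Fin m => F i)
      (g := fun i => F (o i)) fun i _ => hF.monotone (hle i)).1 hs.symm i (Finset.mem_univ i)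
    exact hF.injective this
  refine exists_perm_of_lt hinj fun i => ?_
  have hi : h i ∈ Finset.univ.image h := Finset.mem_image_of_mem h (Finset.mem_univ i)
  rw [← Finset.image_orderEmbOfFin_univ _ hcard] at hi
  obtain ⟨j, -, hj⟩ := Finset.mem_image.1 hi
  rw [← hj, ← show (j : ℕ) = _ from heq j]
  exact j.isLt

lemma natAbs_rho (t : WeylType) (a : Fin m) : (rho t m a).natAbs = 2 * (a : ℕ) + t.e := by
  simp only [rho]; omega

/-- The Laplace eigenvalue of the exponent `v`. -/
def sqSum (v : Fin m → ℤ) : ℤ := ∑ a, v a ^ 2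

lemma coeff_lap (g : Laurent m) (v : Fin m → ℤ) : (lap g).coeff v = sqSum v * g.coeff v := by
  simp [lap, sqSum]

lemma sqSum_eq_of_perm (t : WeylType) {v : Fin m → ℤ} (σ : Equiv.Perm (Fin m))
    (h : ∀ a, (v a).natAbs = (rho t m (σ a)).natAbs) : sqSum v = rhoSq t m := by
  have h1 : ∀ a, v a ^ 2 = (2 * ((σ a : Fin m) : ℕ) + t.e : ℤ) ^ 2 := by
    intro a
    rw [← Int.natAbs_sq, h a, natAbs_rho]
    push_cast
    ring
  rw [sqSum, Finset.sum_congr rfl fun a _ => h1 a, rhoSq]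
  push_cast
  exact Equiv.sum_comp σ fun a : Fin m => (2 * ((a : ℕ) : ℤ) + t.e) ^ 2

lemma sqSum_rho (t : WeylType) : sqSum (rho t m) = rhoSq t m :=
  sqSum_eq_of_perm t (Equiv.refl _) fun _ => rfl

lemma Alternating.exists_perm {t : WeylType} {g : Laurent m} (hg : Alternating t g)
    {v : Fin m → ℤ} (hv : g.coeff v ≠ 0) (hs : sqSum v = rhoSq t m) :
    ∃ σ : Equiv.Perm (Fin m), ∀ a, (v a).natAbs = (rho t m (σ a)).natAbs := by
  choose h hh using hg.exists_natAbs_eq hv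
  have hinj : Function.Injective h := fun a b hab =>
    hg.natAbs_injective hv (by simp only [hh, hab])
  have hF : StrictMono fun i : ℕ => (2 * i + t.e) ^ 2 := fun i j hij => by
    simp only
    gcongr
  obtain ⟨σ, hσ⟩ := exists_perm_of_sum_eq hinj hF (by
    have : ∀ a, v a ^ 2 = ((2 * h a + t.e : ℕ) : ℤ) ^ 2 := fun a => by
      rw [← Int.natAbs_sq, hh a]
    rw [sqSum, Finset.sum_congr rfl fun a _ => this a, rhoSq] at hs
    exact_mod_cast hs)
  exact ⟨σ, fun a => by rw [hh, natAbs_rho, hσ]⟩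

lemma weyl_support (t : WeylType) {v : Fin m → ℤ} (hv : (weyl t m).coeff v ≠ 0) :
    ∃ σ : Equiv.Perm (Fin m), ∀ a, (v a).natAbs = (rho t m (σ a)).natAbs := by
  have hg := alternating_weyl (m := m) t
  choose h hh using hg.exists_natAbs_eq hv
  have hinj : Function.Injective h := fun a b hab =>
    hg.natAbs_injective hv (by simp only [hh, hab])
  obtain ⟨σ, hσ⟩ := exists_perm_of_lt hinj fun a => by
    have h1 := degLE_weyl t a v hv
    have h2 := hh a
    have h3 := a.isLt
    omega
  exact ⟨σ, fun a => by rw [hh, natAbs_rho, hσ]⟩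

lemma lap_weyl (t : WeylType) : lap (weyl t m) = (rhoSq t m : ℂ) • weyl t m := by
  ext v
  rw [coeff_lap, AddMonoidAlgebra.coeff_smul_apply]
  by_cases hv : (weyl t m).coeff v = 0
  · simp [hv]
  · obtain ⟨σ, hσ⟩ := weyl_support t hv
    rw [sqSum_eq_of_perm t σ hσ]
    simp

lemma coeff_weyl_rho_ne_zero (t : WeylType) (m : ℕ) : (weyl t m).coeff (rho t m) ≠ 0 := by
  have h : ∃ v, (weyl t m).coeff v ≠ 0 := by
    by_contra! h
    exact weyl_ne_zero t m (by ext v; simp [h])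
  obtain ⟨v, hv⟩ := h
  obtain ⟨σ, hσ⟩ := weyl_support t hv
  rw [← norm_ne_zero_iff, ← (alternating_weyl t).norm_coeff_eq σ hσ, norm_ne_zero_iff]
  exact hv

lemma norm_coeff_weyl_le (t : WeylType) (v : Fin m → ℤ) :
    ‖(weyl t m).coeff v‖ ≤ ‖(weyl t m).coeff (rho t m)‖ := by
  by_cases hv : (weyl t m).coeff v = 0
  · simp [hv]
  · obtain ⟨σ, hσ⟩ := weyl_support t hv
    exact ((alternating_weyl t).norm_coeff_eq σ hσ).le

/-- A functional annihilating the image of the Laplacian is given by the Weyl integration formula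
in coefficient form. -/
theorem functional_eq_coeff (t : WeylType) (E : MvPolynomial ℕ ℂ →ₗ[ℂ] ℂ) (M : ℂ)
    (hlap : ∀ f, ∃ f', E f' = 0 ∧ torusEval t m f' * weyl t m =
      lap (torusEval t m f * weyl t m) - (rhoSq t m : ℂ) • (torusEval t m f * weyl t m))
    (hconst : ∀ f c, torusEval t m f = algebraMap ℂ _ c → E f = c * M) (f : MvPolynomial ℕ ℂ) :
    E f = (torusEval t m f * weyl t m).coeff (rho t m) / (weyl t m).coeff (rho t m) * M := by
  classical
  have main : ∀ S : Finset ℤ, (rhoSq t m : ℤ) ∉ S → ∀ f : MvPolynomial ℕ ℂ,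
      (∀ v, (torusEval t m f * weyl t m).coeff v ≠ 0 → sqSum v = rhoSq t m ∨ sqSum v ∈ S) →
      E f = (torusEval t m f * weyl t m).coeff (rho t m) / (weyl t m).coeff (rho t m) * M := by
    intro S
    induction S using Finset.induction_on with
    | empty =>
      intro _ f hf
      set c := (torusEval t m f * weyl t m).coeff (rho t m) / (weyl t m).coeff (rho t m) with hc
      apply hconst
      have h0 : torusEval t m (f - MvPolynomial.C c) * weyl t m =
          torusEval t m f * weyl t m - c • weyl t m := by
        rw [map_sub, sub_mul, torusEval, MvPolynomial.aeval_C, ← Algebra.smul_def]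
      have h1 : torusEval t m (f - MvPolynomial.C c) * weyl t m = 0 := by
        ext v
        rw [AddMonoidAlgebra.coeff_zero, Finsupp.zero_apply]
        by_contra hv
        have hs : sqSum v = rhoSq t m := by
          rw [h0, AddMonoidAlgebra.coeff_sub, Finsupp.sub_apply,
            AddMonoidAlgebra.coeff_smul_apply] at hv
          by_cases h2 : (torusEval t m f * weyl t m).coeff v = 0
          · rw [h2, zero_sub, neg_eq_zero, smul_eq_mul] at hv
            obtain ⟨σ, hσ⟩ := weyl_support t (right_ne_zero_of_mul (show _ ≠ (0 : ℂ) from hv))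
            exact sqSum_eq_of_perm t σ hσ
          · simpa using hf v h2
        have hg := alternating_torusEval (m := m) t (f - MvPolynomial.C c)
        obtain ⟨σ, hσ⟩ := hg.exists_perm hv hs
        rw [← norm_eq_zero, hg.norm_coeff_eq σ hσ, norm_eq_zero] at hv
        apply hv
        rw [h0, AddMonoidAlgebra.coeff_sub, Finsupp.sub_apply,
            AddMonoidAlgebra.coeff_smul_apply, hc, smul_eq_mul,
            div_mul_cancel₀ _ (coeff_weyl_rho_ne_zero t m), sub_self]
      have h2 := (mul_eq_zero.1 h1).resolve_right (weyl_ne_zero t m)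
      rw [map_sub, sub_eq_zero] at h2
      rw [h2, torusEval, MvPolynomial.aeval_C]
    | insert μ S hμ ih =>
      intro hS f hf
      have hne : (rhoSq t m : ℂ) ≠ μ := by
        intro h
        apply hS
        rw [show (rhoSq t m : ℤ) = μ by exact_mod_cast h]
        exact Finset.mem_insert_self μ S
      have hne' : (μ - rhoSq t m : ℂ) ≠ 0 := sub_ne_zero.2 hne.symm
      obtain ⟨f', hE, hf'⟩ := hlap f
      have hco : ∀ v, (torusEval t m (f - (μ - rhoSq t m : ℂ)⁻¹ • f') * weyl t m).coeff v =
          (1 - (μ - rhoSq t m : ℂ)⁻¹ * (sqSum v - rhoSq t m)) *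
            (torusEval t m f * weyl t m).coeff v := by
        intro v
        rw [map_sub, map_smul, sub_mul, smul_mul_assoc, hf', AddMonoidAlgebra.coeff_sub,
          Finsupp.sub_apply, AddMonoidAlgebra.coeff_smul_apply, AddMonoidAlgebra.coeff_sub,
          Finsupp.sub_apply, AddMonoidAlgebra.coeff_smul_apply, coeff_lap]
        simp only [smul_eq_mul]
        ring
      have h := ih (fun h => hS (Finset.mem_insert_of_mem h))
        (f - (μ - rhoSq t m : ℂ)⁻¹ • f') fun v hv => by
          rw [hco] at hv
          have h2 := hf v (right_ne_zero_of_mul hv)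
          rw [Finset.mem_insert] at h2
          rcases h2 with h2 | h2 | h2
          · exact Or.inl h2
          · exact absurd (by rw [h2, inv_mul_cancel₀ hne', sub_self]) (left_ne_zero_of_mul hv)
          · exact Or.inr h2
      rw [map_sub, map_smul, hE, smul_zero, sub_zero, hco, sqSum_rho] at h
      simpa using h
  refine main (((torusEval t m f * weyl t m).coeff.support.image sqSum).erase (rhoSq t m))
    (Finset.notMem_erase _ _) f fun v hv => ?_
  by_cases h : sqSum v = rhoSq t m
  · exact Or.inl h
  · exact Or.inr (Finset.mem_erase.2 ⟨h, Finset.mem_image_of_mem _ (Finsupp.mem_support_iff.2 hv)⟩)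

lemma coeff_fullSum_mul (t : WeylType) (k : ℕ) (g : Laurent m) (v : Fin m → ℤ) :
    (fullSum t m k * g).coeff v = ∑ a, g.coeff (v - Pi.single a (2 * k : ℤ)) +
      ∑ a, g.coeff (v - Pi.single a (-(2 * k) : ℤ)) + t.s k * g.coeff v := by
  rw [fullSum, add_mul, AddMonoidAlgebra.coeff_add, Finsupp.add_apply, intCast_mul_coeff]
  congr 1
  rw [← Finset.sum_add_distrib, powSum, Finset.sum_mul, AddMonoidAlgebra.coeff_sum,
    Finset.sum_apply']
  refine Finset.sum_congr rfl fun a _ => ?_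
  rw [add_mul, AddMonoidAlgebra.coeff_add, Finsupp.add_apply, coeff_zp_mul, coeff_zp_mul]

lemma WeylType.norm_s_le (t : WeylType) (k : ℕ) : ‖(t.s k : ℂ)‖ ≤ 2 := by
  have h : ‖((-1 : ℂ)) ^ k‖ = 1 := by simp
  have h2 : ‖(t.s k : ℂ)‖ ≤ t.α + t.β := by
    rw [WeylType.s]
    push_cast
    refine (norm_add_le _ _).trans ?_
    rw [norm_mul, h]
    simp
  refine h2.trans ?_
  cases t <;> simp [WeylType.α, WeylType.β]
  norm_num

lemma sqSum_sub_single (v : Fin m → ℤ) (a : Fin m) (n : ℤ) :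
    sqSum (v - Pi.single a n) = sqSum v - 2 * n * v a + n ^ 2 := by
  have h : ∀ b, ((v - Pi.single a n : Fin m → ℤ) b) ^ 2 =
      v b ^ 2 + if b = a then (- 2 * n * v a + n ^ 2) else 0 := by
    intro b
    by_cases hb : b = a
    · subst hb; simp; ring
    · simp [hb]
  rw [sqSum, Finset.sum_congr rfl fun b _ => h b, Finset.sum_add_distrib, sqSum]
  simp
  ring

lemma norm_sum_coeff_weyl_le (t : WeylType) {v : Fin m → ℤ}
    (hv : Function.Injective v) {n : ℤ} (hn : n ≠ 0) :
    ‖∑ a, (weyl t m).coeff (v - Pi.single a n)‖ ≤ ‖(weyl t m).coeff (rho t m)‖ := by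
  by_cases h : ∃ a, (weyl t m).coeff (v - Pi.single a n) ≠ 0
  · obtain ⟨a, ha⟩ := h
    rw [Finset.sum_eq_single a]
    · exact norm_coeff_weyl_le t _
    · intro b _ hba
      by_contra hb
      apply hba
      obtain ⟨σ, hσ⟩ := weyl_support t ha
      obtain ⟨τ, hτ⟩ := weyl_support t hb
      have h1 := sqSum_eq_of_perm t σ hσ
      have h2 := sqSum_eq_of_perm t τ hτ
      rw [sqSum_sub_single] at h1 h2
      have h3 : (2 * n) * v a = (2 * n) * v b := by linarith
      exact hv (mul_left_cancel₀ (by simpa using hn) h3).symm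
    · simp
  · push Not at h
    simp [h]

lemma norm_coeff_fullSum_mul_weyl_le (t : WeylType) {k : ℕ} (hk : 0 < k) (v : Fin m → ℤ) :
    ‖(fullSum t m k * weyl t m).coeff v‖ ≤ 4 * ‖(weyl t m).coeff (rho t m)‖ := by
  have hg : Alternating t (fullSum t m k * weyl t m) := by
    simpa [torusEval] using alternating_torusEval (m := m) t (MvPolynomial.X k)
  by_cases h0 : (fullSum t m k * weyl t m).coeff v = 0
  · rw [h0]; simp
  · have hv : Function.Injective v := fun a b hab => by
      by_contra hne
      exact hg.ne_of_coeff_ne_zero h0 hne hab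
    rw [coeff_fullSum_mul]
    have h1 := norm_sum_coeff_weyl_le t hv (n := 2 * k) (by positivity)
    have h2 := norm_sum_coeff_weyl_le t hv (n := -(2 * k)) (by simp; omega)
    have h3 : ‖(t.s k : ℂ) * (weyl t m).coeff v‖ ≤ 2 * ‖(weyl t m).coeff (rho t m)‖ := by
      rw [norm_mul]
      exact mul_le_mul (t.norm_s_le k) (norm_coeff_weyl_le t v) (norm_nonneg _) (by norm_num)
    refine (norm_add₃_le).trans ?_
    linarith

lemma sum_norm_le_of_card {ι : Type*} [Fintype ι] (f : ι → ℂ) (s : Finset ι) {B : ℝ}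
    (hB : ∀ i, ‖f i‖ ≤ B) (hs : ∀ i, f i ≠ 0 → i ∈ s) : ‖∑ i, f i‖ ≤ s.card * B := by
  rw [← Finset.sum_subset (Finset.subset_univ s) fun i _ hi => by
    by_contra h
    exact hi (hs i h)]
  refine (norm_sum_le_of_le s fun i _ => hB i).trans ?_
  simp

lemma norm_coeff_sq_le (t : WeylType) {k : ℕ} (hk : 0 < k) :
    ‖(torusEval t m (MvPolynomial.X k ^ 2) * weyl t m).coeff (rho t m)‖ ≤
      8 * (min k m + 1) * ‖(weyl t m).coeff (rho t m)‖ := by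
  have hg : Alternating t (fullSum t m k * weyl t m) := by
    simpa [torusEval] using alternating_torusEval (m := m) t (MvPolynomial.X k)
  have h0 : torusEval t m (MvPolynomial.X k ^ 2) * weyl t m =
      fullSum t m k * (fullSum t m k * weyl t m) := by
    simp [torusEval]; ring
  have hB := norm_coeff_fullSum_mul_weyl_le (m := m) t hk
  rw [h0, coeff_fullSum_mul]
  set G := fullSum t m k * weyl t m
  set B := ‖(weyl t m).coeff (rho t m)‖
  have hBnn : 0 ≤ B := norm_nonneg _
  have h1 : ‖∑ a, G.coeff (rho t m - Pi.single a (2 * k : ℤ))‖ ≤ (min k m : ℕ) * (4 * B) := by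
    refine (sum_norm_le_of_card _ (Finset.univ.filter fun a : Fin m => (a : ℕ) < k)
      (fun a => hB _) fun a ha => ?_).trans ?_
    · by_contra hak
      simp only [Finset.mem_filter, Finset.mem_univ, true_and, not_lt] at hak
      have hlt : (a : ℕ) - k < m := by have := a.isLt; omega
      have hne : a ≠ ⟨a - k, hlt⟩ := by
        intro h
        have := congrArg Fin.val h
        simp only at this
        omega
      refine hg.ne_of_coeff_ne_zero ha hne ?_
      simp [hne.symm, rho]
      push_cast [hak]
      ring
    · have hc : (Finset.univ.filter fun a : Fin m => (a : ℕ) < k).card ≤ min k m := by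
        rw [le_min_iff]
        constructor
        · rw [← Finset.card_map Fin.valEmbedding, ← Finset.card_range k]
          refine Finset.card_le_card fun x hx => ?_
          simp only [Finset.mem_map, Finset.mem_filter] at hx
          obtain ⟨a, ha, rfl⟩ := hx
          simpa using ha.2
        · exact (Finset.card_filter_le _ _).trans (by simp)
      gcongr
  have h2 : ‖∑ a, G.coeff (rho t m - Pi.single a (-(2 * k) : ℤ))‖ ≤ (min k m : ℕ) * (4 * B) := by
    refine (sum_norm_le_of_card _ (Finset.univ.filter fun a : Fin m => m ≤ (a : ℕ) + k)
      (fun a => hB _) fun a ha => ?_).trans ?_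
    · by_contra hak
      simp only [Finset.mem_filter, Finset.mem_univ, true_and, not_le] at hak
      have hne : a ≠ ⟨a + k, hak⟩ := by
        intro h
        have := congrArg Fin.val h
        simp only at this
        omega
      refine hg.ne_of_coeff_ne_zero ha hne ?_
      simp [hne.symm, rho]
      ring
    · have hc : (Finset.univ.filter fun a : Fin m => m ≤ (a : ℕ) + k).card ≤ min k m := by
        rw [le_min_iff]
        constructor
        · rw [← Finset.card_map Fin.valEmbedding]
          have : (Finset.Ico (m - k) m).card ≤ k := by simp; omega
          refine (Finset.card_le_card fun x hx => ?_).trans this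
          simp only [Finset.mem_map, Finset.mem_filter] at hx
          obtain ⟨a, ha, rfl⟩ := hx
          have h1 := ha.2
          have h2 := a.isLt
          simp only [Fin.valEmbedding_apply, Finset.mem_Ico]
          omega
        · exact (Finset.card_filter_le _ _).trans (by simp)
      gcongr
  have h3 : ‖(t.s k : ℂ) * G.coeff (rho t m)‖ ≤ 2 * (4 * B) := by
    rw [norm_mul]
    exact mul_le_mul (t.norm_s_le k) (hB _) (norm_nonneg _) (by norm_num)
  refine (norm_add₃_le).trans ?_
  push_cast at h1 h2 ⊢
  linarith

end

section

/-- A unitary matrix `J` with `Jᵀ = ηJ`, `η = ±1`, viewed as a bilinear form. -/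
structure BilinForm (ι : Type*) [Fintype ι] [DecidableEq ι] where
  J : Matrix ι ι ℂ
  η : ℤ
  mul_conjTranspose : J * Jᴴ = 1
  transpose_eq : Jᵀ = (η : ℂ) • J
  η_mul_self : η * η = 1

variable {ι : Type*} [Fintype ι] [DecidableEq ι]

namespace BilinForm

variable (B : BilinForm ι)

/-- The adjoint involution of the form. -/
def sharp (A : Matrix ι ι ℂ) : Matrix ι ι ℂ := B.J * Aᵀ * B.Jᴴ

/-- The isometry condition. -/
def IsIsometry (U : Matrix ι ι ℂ) : Prop := U * B.J * Uᵀ = B.J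

lemma conjTranspose_mul : B.Jᴴ * B.J = 1 := mul_eq_one_comm.1 B.mul_conjTranspose

lemma η_mul_self' : (B.η : ℂ) * B.η = 1 := by exact_mod_cast B.η_mul_self

lemma conjTranspose_transpose : B.Jᴴᵀ = (B.η : ℂ) • B.Jᴴ := by
  have h : B.Jᴴᵀ = B.Jᵀᴴ := rfl
  rw [h, B.transpose_eq, conjTranspose_smul]
  simp

lemma sharp_mul (A C : Matrix ι ι ℂ) : B.sharp (A * C) = B.sharp C * B.sharp A := by
  simp only [sharp, transpose_mul]
  calc B.J * (Cᵀ * Aᵀ) * B.Jᴴ = B.J * Cᵀ * 1 * Aᵀ * B.Jᴴ := by simp only [mul_one, mul_assoc]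
    _ = _ := by rw [← B.conjTranspose_mul]; simp only [mul_assoc]

lemma sharp_sharp (A : Matrix ι ι ℂ) : B.sharp (B.sharp A) = A := by
  simp only [sharp, transpose_mul, conjTranspose_transpose, B.transpose_eq, transpose_transpose]
  simp only [Matrix.smul_mul, Matrix.mul_smul, smul_smul, B.η_mul_self', one_smul]
  rw [← mul_assoc, ← mul_assoc, B.mul_conjTranspose, one_mul, mul_assoc, B.mul_conjTranspose,
    mul_one]

lemma sharp_sub (A C : Matrix ι ι ℂ) : B.sharp (A - C) = B.sharp A - B.sharp C := by
  simp [sharp, Matrix.mul_sub, Matrix.sub_mul]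

lemma sharp_add (A C : Matrix ι ι ℂ) : B.sharp (A + C) = B.sharp A + B.sharp C := by
  simp [sharp, Matrix.mul_add, Matrix.add_mul]

lemma sharp_smul (c : ℂ) (A : Matrix ι ι ℂ) : B.sharp (c • A) = c • B.sharp A := by
  simp [sharp]

lemma sharp_conjTranspose (A : Matrix ι ι ℂ) : B.sharp Aᴴ = (B.sharp A)ᴴ := by
  simp only [sharp, Matrix.conjTranspose_mul, conjTranspose_conjTranspose,
    mul_assoc]
  rfl

lemma trace_sharp (A : Matrix ι ι ℂ) : trace (B.sharp A) = trace A := by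
  rw [sharp, trace_mul_comm, ← mul_assoc, B.conjTranspose_mul, one_mul, trace_transpose]

lemma trace_sharp_mul_comm (A C : Matrix ι ι ℂ) :
    trace (A * B.sharp C) = trace (B.sharp A * C) := by
  rw [← B.trace_sharp, B.sharp_mul, B.sharp_sharp, trace_mul_comm]

variable {B} in
lemma IsIsometry.mul_sharp {U : Matrix ι ι ℂ} (hU : B.IsIsometry U) : U * B.sharp U = 1 := by
  rw [sharp, ← mul_assoc, ← mul_assoc, hU, B.mul_conjTranspose]

variable {B} in
lemma IsIsometry.pow {U : Matrix ι ι ℂ} (hU : B.IsIsometry U) (k : ℕ) : B.IsIsometry (U ^ k) := by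
  induction k with
  | zero => simp [IsIsometry]
  | succ k ih =>
    unfold IsIsometry at *
    rw [pow_succ, transpose_mul]
    calc U ^ k * U * B.J * (Uᵀ * (U ^ k)ᵀ) = U ^ k * (U * B.J * Uᵀ) * (U ^ k)ᵀ := by
          simp only [mul_assoc]
      _ = _ := by rw [hU, ih]

variable {B} in
lemma IsIsometry.trace_sharp_pow_mul_pow {U : Matrix ι ι ℂ} (hU : B.IsIsometry U) (k l : ℕ) :
    trace (B.sharp (U ^ k) * U ^ l) = trace (U ^ (k - l : ℤ).natAbs) := by
  have key : ∀ {k l : ℕ}, k ≤ l → B.sharp (U ^ k) * U ^ l = U ^ (l - k) := by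
    intro k l h
    rw [← Nat.add_sub_cancel' h, pow_add, ← mul_assoc, mul_eq_one_comm.1 (hU.pow k).mul_sharp,
      one_mul, Nat.add_sub_cancel_left]
  rcases le_total k l with h | h
  · rw [key h, show (k - l : ℤ).natAbs = l - k by omega]
  · rw [← B.trace_sharp, B.sharp_mul, B.sharp_sharp, key h,
      show (k - l : ℤ).natAbs = k - l by omega]

/-- A spanning family of the complexified Lie algebra of the isometry group. -/
def lieElt (i j : ι) : Matrix ι ι ℂ := single i j 1 - B.sharp (single i j 1)

lemma sharp_lieElt (i j : ι) : B.sharp (B.lieElt i j) = -B.lieElt i j := by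
  simp [lieElt, sharp_sub, sharp_sharp]

lemma trace_lieElt_mul (i j : ι) (A : Matrix ι ι ℂ) :
    trace (B.lieElt i j * A) = (A - B.sharp A) j i := by
  rw [lieElt, Matrix.sub_mul, trace_sub, ← B.trace_sharp_mul_comm, trace_single_mul,
    trace_single_mul]
  simp

lemma sum_trace_lieElt_mul_trace (A C : Matrix ι ι ℂ) :
    ∑ i, ∑ j, trace (B.lieElt i j * A) * trace (B.lieElt j i * C) =
      2 * trace (A * C) - 2 * trace (B.sharp A * C) := by
  have h : ∑ i, ∑ j, trace (B.lieElt i j * A) * trace (B.lieElt j i * C) =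
      trace ((A - B.sharp A) * (C - B.sharp C)) := by
    rw [Finset.sum_comm]
    simp only [trace_lieElt_mul]
    simp only [trace, diag_apply, Matrix.mul_apply]
  rw [h, Matrix.sub_mul, Matrix.mul_sub, Matrix.mul_sub, trace_sub, trace_sub, trace_sub,
    B.trace_sharp_mul_comm, ← B.sharp_mul, B.trace_sharp, trace_mul_comm C A]
  ring

lemma trace_single_mul_single_mul (i j k l : ι) (A C : Matrix ι ι ℂ) :
    trace (single i j 1 * A * single k l 1 * C) = A j k * C l i := by
  rw [mul_assoc, mul_assoc, trace_single_mul, Matrix.mul_apply]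
  simp [Matrix.mul_apply, single_apply, ite_and]

lemma sum_trace_lieElt_mul_lieElt (A C : Matrix ι ι ℂ) :
    ∑ i, ∑ j, trace (B.lieElt i j * A * B.lieElt j i * C) =
      2 * trace A * trace C - 2 * B.η * trace (B.sharp A * C) := by
  have hs : ∀ i j, B.sharp (single i j 1) = B.J * single j i 1 * B.Jᴴ := fun i j => by
    rw [sharp, transpose_single]
  have h1 : ∑ i, ∑ j, trace (single i j 1 * A * single j i 1 * C) = trace A * trace C := by
    simp only [trace_single_mul_single_mul]
    simp only [trace, diag_apply, Finset.sum_mul_sum]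
    rw [Finset.sum_comm]
  have h2 : ∑ i, ∑ j, trace (single i j 1 * A * B.sharp (single j i 1) * C) =
      B.η * trace (B.sharp A * C) := by
    have : ∀ i j, trace (single i j 1 * A * B.sharp (single j i 1) * C) =
        (A * B.J) j i * (B.Jᴴ * C) j i := fun i j => by
      rw [← trace_single_mul_single_mul, hs]
      simp only [mul_assoc]
    have h : B.η * trace (B.sharp A * C) = trace ((A * B.J)ᵀ * (B.Jᴴ * C)) := by
      rw [transpose_mul, B.transpose_eq, sharp]
      simp [mul_assoc]
    rw [h]
    simp only [this]
    simp only [trace, diag_apply, Matrix.mul_apply (M := (A * B.J)ᵀ), transpose_apply]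
  have h3 : ∑ i, ∑ j, trace (B.sharp (single i j 1) * A * single j i 1 * C) =
      B.η * trace (B.sharp A * C) := by
    have : ∀ i j, trace (B.sharp (single i j 1) * A * single j i 1 * C) =
        (B.Jᴴ * A) i j * (C * B.J) i j := fun i j => by
      rw [← trace_single_mul_single_mul, hs, show B.J * single j i 1 * B.Jᴴ * A * single j i 1 * C =
        B.J * (single j i 1 * B.Jᴴ * A * single j i 1 * C) by simp only [mul_assoc],
        trace_mul_comm]
      simp only [mul_assoc]
    have h : B.η * trace (B.sharp A * C) = trace ((B.Jᴴ * A) * (C * B.J)ᵀ) := by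
      rw [transpose_mul, B.transpose_eq, ← B.trace_sharp_mul_comm, sharp, mul_assoc B.Jᴴ,
        trace_mul_comm B.Jᴴ]
      simp [mul_assoc]
    rw [h]
    simp only [this]
    simp only [trace, diag_apply, Matrix.mul_apply (N := (C * B.J)ᵀ), transpose_apply]
  have h4 : ∑ i, ∑ j, trace (B.sharp (single i j 1) * A * B.sharp (single j i 1) * C) =
      trace A * trace C := by
    have : ∀ i j, trace (B.sharp (single i j 1) * A * B.sharp (single j i 1) * C) =
        (B.Jᴴ * A * B.J) i i * (B.Jᴴ * C * B.J) j j := fun i j => by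
      rw [← trace_single_mul_single_mul, hs, hs,
        show B.J * single j i 1 * B.Jᴴ * A * (B.J * single i j 1 * B.Jᴴ) * C =
          B.J * (single j i 1 * B.Jᴴ * A * B.J * single i j 1 * B.Jᴴ * C) by simp only [mul_assoc],
        trace_mul_comm]
      simp only [mul_assoc]
    simp only [this]
    rw [← Finset.sum_mul_sum]
    change trace (B.Jᴴ * A * B.J) * trace (B.Jᴴ * C * B.J) = _
    rw [trace_mul_comm, ← mul_assoc, B.mul_conjTranspose, trace_mul_comm (B.Jᴴ * C), ← mul_assoc,
      B.mul_conjTranspose, one_mul, one_mul]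
  simp only [lieElt, Matrix.sub_mul, Matrix.mul_sub, trace_sub, Finset.sum_sub_distrib, h1, h2, h3,
    h4]
  ring

end BilinForm

end

section

variable {ι : Type*} [Fintype ι] [DecidableEq ι]

/-- Polynomials in the entries of a matrix. -/
abbrev EntryPoly (ι : Type*) := MvPolynomial (ι × ι) ℂ

/-- The generic matrix. -/
def genMat (ι : Type*) : Matrix ι ι (EntryPoly ι) := mvPolynomialX ι ι ℂ

/-- Evaluation of a polynomial in the entries at a matrix. -/
def entryEval {ι : Type*} (U : Matrix ι ι ℂ) : EntryPoly ι →ₐ[ℂ] ℂ := MvPolynomial.aeval fun p => U p.1 p.2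

/-- The right-invariant vector field `U ↦ ZU`. -/
def invDeriv {ι : Type*} [Fintype ι] (Z : Matrix ι ι ℂ) : Derivation ℂ (EntryPoly ι) (EntryPoly ι) :=
  MvPolynomial.mkDerivation ℂ fun p =>
    (Z.map MvPolynomial.C * genMat ι : Matrix ι ι (EntryPoly ι)) p.1 p.2

lemma genMat_map_entryEval {ι : Type*} (U : Matrix ι ι ℂ) : (genMat ι).map (entryEval U) = U := by
  ext i j; simp [genMat, entryEval]

lemma genMat_map_invDeriv {ι : Type*} [Fintype ι] (Z : Matrix ι ι ℂ) :
    (genMat ι).map (invDeriv Z) = Z.map MvPolynomial.C * genMat ι := by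
  ext1 i j; simp [genMat, invDeriv]

lemma map_derivation_mul {ι : Type*} [Fintype ι] {A : Type*} [CommRing A] [Algebra ℂ A] (D : Derivation ℂ A A)
    (M N : Matrix ι ι A) : (M * N).map D = M.map D * N + M * N.map D := by
  ext1 i j
  simp only [map_apply, Matrix.mul_apply, map_sum, Derivation.leibniz, smul_eq_mul,
    Matrix.add_apply, Finset.sum_add_distrib]
  rw [add_comm]
  congr 1
  exact Finset.sum_congr rfl fun _ _ => mul_comm _ _

lemma map_derivation_pow {A : Type*} [CommRing A] [Algebra ℂ A] (D : Derivation ℂ A A)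
    (M : Matrix ι ι A) (k : ℕ) :
    (M ^ k).map D = ∑ i ∈ Finset.range k, M ^ i * M.map D * M ^ (k - 1 - i) := by
  induction k with
  | zero => ext1 i j; by_cases h : i = j <;> simp [h]
  | succ k ih =>
    rw [pow_succ, map_derivation_mul, ih, Finset.sum_range_succ, Finset.sum_mul]
    congr 1
    · refine Finset.sum_congr rfl fun i hi => ?_
      rw [Finset.mem_range] at hi
      rw [mul_assoc _ _ M, ← pow_succ]
      congr 2
      omega
    · simp

lemma trace_map_derivation {ι : Type*} [Fintype ι] {A : Type*} [CommRing A] [Algebra ℂ A] (D : Derivation ℂ A A)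
    (M : Matrix ι ι A) : trace (M.map D) = D (trace M) := by
  simp [trace]

lemma genMat_pow_map_invDeriv (Z : Matrix ι ι ℂ) (k : ℕ) :
    (genMat ι ^ k).map (invDeriv Z) = ∑ i ∈ Finset.range k,
      genMat ι ^ i * Z.map MvPolynomial.C * genMat ι ^ (k - i) := by
  rw [map_derivation_pow]
  refine Finset.sum_congr rfl fun i hi => ?_
  rw [Finset.mem_range] at hi
  rw [genMat_map_invDeriv, ← mul_assoc, mul_assoc _ (genMat ι), ← pow_succ']
  congr 2
  omega

lemma invDeriv_trace_pow (Z : Matrix ι ι ℂ) (k : ℕ) :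
    invDeriv Z (trace (genMat ι ^ k)) = k * trace (Z.map MvPolynomial.C * genMat ι ^ k) := by
  rw [← trace_map_derivation, genMat_pow_map_invDeriv, trace_sum, ← nsmul_eq_mul]
  refine (Finset.sum_congr rfl fun i hi => ?_).trans (by rw [Finset.sum_const, Finset.card_range])
  rw [Finset.mem_range] at hi
  rw [trace_mul_comm, ← mul_assoc, ← pow_add, trace_mul_comm, Nat.sub_add_cancel hi.le]

lemma invDeriv_invDeriv_trace_pow (Z W : Matrix ι ι ℂ) (k : ℕ) :
    invDeriv W (invDeriv Z (trace (genMat ι ^ k))) = k * ∑ i ∈ Finset.range k,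
      trace (Z.map MvPolynomial.C * genMat ι ^ i * W.map MvPolynomial.C * genMat ι ^ (k - i)) := by
  have hZ : (Z.map MvPolynomial.C).map (invDeriv W) = 0 := by
    ext1 i j; simp
  rw [invDeriv_trace_pow, Derivation.leibniz, Derivation.map_natCast, smul_zero, add_zero,
    smul_eq_mul, ← trace_map_derivation, map_derivation_mul, hZ, zero_mul, zero_add,
    genMat_pow_map_invDeriv, Finset.mul_sum, trace_sum]
  simp only [mul_assoc]

lemma entryEval_trace (U : Matrix ι ι ℂ) (M : Matrix ι ι (EntryPoly ι)) :
    entryEval U (trace M) = trace ((entryEval U).mapMatrix M) := by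
  simp [trace]

lemma entryEval_mapMatrix_genMat (U : Matrix ι ι ℂ) :
    (entryEval U).mapMatrix (genMat ι) = U := genMat_map_entryEval U

lemma entryEval_mapMatrix_C (U Z : Matrix ι ι ℂ) :
    (entryEval U).mapMatrix (Z.map MvPolynomial.C) = Z := by
  ext i j; simp [entryEval]

lemma entryEval_trace_pow (U : Matrix ι ι ℂ) (k : ℕ) :
    entryEval U (trace (genMat ι ^ k)) = trace (U ^ k) := by
  rw [entryEval_trace, map_pow, entryEval_mapMatrix_genMat]

lemma entryEval_invDeriv_trace_pow (U Z : Matrix ι ι ℂ) (k : ℕ) :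
    entryEval U (invDeriv Z (trace (genMat ι ^ k))) = k * trace (Z * U ^ k) := by
  rw [invDeriv_trace_pow, map_mul, map_natCast, entryEval_trace, map_mul, map_pow,
    entryEval_mapMatrix_genMat, entryEval_mapMatrix_C]

lemma entryEval_invDeriv_invDeriv_trace_pow (U Z W : Matrix ι ι ℂ) (k : ℕ) :
    entryEval U (invDeriv W (invDeriv Z (trace (genMat ι ^ k)))) = k * ∑ i ∈ Finset.range k,
      trace (Z * U ^ i * W * U ^ (k - i)) := by
  rw [invDeriv_invDeriv_trace_pow, map_mul, map_natCast, map_sum]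
  simp only [entryEval_trace, map_mul, map_pow, entryEval_mapMatrix_genMat, entryEval_mapMatrix_C]

/-- The polynomial map sending the `k`th variable to the trace of the `k`th power. -/
def tracePoly (ι : Type*) [Fintype ι] [DecidableEq ι] : MvPolynomial ℕ ℂ →ₐ[ℂ] EntryPoly ι :=
  MvPolynomial.aeval fun k => trace (genMat ι ^ k)

lemma tracePoly_X (k : ℕ) : tracePoly ι (MvPolynomial.X k) = trace (genMat ι ^ k) := by
  simp [tracePoly]

namespace BilinForm

variable (B : BilinForm ι)

/-- The Laplacian of the isometry group. -/
def laplacian : EntryPoly ι →ₗ[ℂ] EntryPoly ι :=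
  2 • ∑ i, ∑ j, (invDeriv (B.lieElt i j)).toLinearMap ∘ₗ (invDeriv (B.lieElt j i)).toLinearMap

/-- The carré du champ of the isometry group. -/
def gradient (f g : EntryPoly ι) : EntryPoly ι :=
  2 * ∑ i, ∑ j, invDeriv (B.lieElt i j) f * invDeriv (B.lieElt j i) g

lemma laplacian_apply (f : EntryPoly ι) : B.laplacian f =
    2 * ∑ i, ∑ j, invDeriv (B.lieElt i j) (invDeriv (B.lieElt j i) f) := by
  simp [laplacian, LinearMap.sum_apply, two_mul, two_smul]

lemma gradient_comm (f g : EntryPoly ι) : B.gradient f g = B.gradient g f := by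
  rw [gradient, gradient, Finset.sum_comm]
  simp only [mul_comm]

lemma laplacian_mul (f g : EntryPoly ι) :
    B.laplacian (f * g) = f * B.laplacian g + g * B.laplacian f + 2 * B.gradient f g := by
  have h : ∀ i j, invDeriv (B.lieElt i j) (invDeriv (B.lieElt j i) (f * g)) =
      f * invDeriv (B.lieElt i j) (invDeriv (B.lieElt j i) g) +
      g * invDeriv (B.lieElt i j) (invDeriv (B.lieElt j i) f) +
      (invDeriv (B.lieElt i j) f * invDeriv (B.lieElt j i) g +
        invDeriv (B.lieElt i j) g * invDeriv (B.lieElt j i) f) := fun i j => by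
    simp only [Derivation.leibniz, smul_eq_mul, map_add]
    ring
  have h2 : 2 * B.gradient f g = B.gradient f g + B.gradient g f := by
    rw [B.gradient_comm g f, two_mul]
  rw [h2]
  simp only [laplacian_apply, gradient, h, Finset.sum_add_distrib, ← Finset.mul_sum]
  ring

lemma gradient_add_left (f f' g : EntryPoly ι) :
    B.gradient (f + f') g = B.gradient f g + B.gradient f' g := by
  simp only [gradient, map_add, add_mul, Finset.sum_add_distrib, mul_add]

lemma gradient_mul_left (f f' g : EntryPoly ι) :
    B.gradient (f * f') g = f * B.gradient f' g + f' * B.gradient f g := by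
  have h : ∀ i j, invDeriv (B.lieElt i j) (f * f') * invDeriv (B.lieElt j i) g =
      f * (invDeriv (B.lieElt i j) f' * invDeriv (B.lieElt j i) g) +
      f' * (invDeriv (B.lieElt i j) f * invDeriv (B.lieElt j i) g) := fun i j => by
    rw [Derivation.leibniz, smul_eq_mul, smul_eq_mul]
    ring
  simp only [gradient, h, Finset.sum_add_distrib, ← Finset.mul_sum]
  ring

lemma gradient_C_left (c : ℂ) (g : EntryPoly ι) : B.gradient (MvPolynomial.C c) g = 0 := by
  simp [gradient]

lemma laplacian_C (c : ℂ) : B.laplacian (MvPolynomial.C c) = 0 := by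
  simp [laplacian_apply]

variable {B}

lemma IsIsometry.entryEval_gradient {U : Matrix ι ι ℂ} (hU : B.IsIsometry U) (k l : ℕ) :
    entryEval U (B.gradient (tracePoly ι (.X k)) (tracePoly ι (.X l))) =
      4 * k * l * (trace (U ^ (k + l)) - trace (U ^ (k - l : ℤ).natAbs)) := by
  have h : ∀ i j, (k * trace (B.lieElt i j * U ^ k)) * (l * trace (B.lieElt j i * U ^ l)) =
      k * l * (trace (B.lieElt i j * U ^ k) * trace (B.lieElt j i * U ^ l)) := fun i j => by ring
  simp only [gradient, tracePoly_X, map_mul, map_sum, entryEval_invDeriv_trace_pow, h,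
    ← Finset.mul_sum, B.sum_trace_lieElt_mul_trace, hU.trace_sharp_pow_mul_pow, map_ofNat]
  rw [pow_add]
  ring

lemma IsIsometry.entryEval_laplacian {U : Matrix ι ι ℂ} (hU : B.IsIsometry U) (k : ℕ) :
    entryEval U (B.laplacian (tracePoly ι (.X k))) = 4 * k * ∑ i ∈ Finset.range k,
      (trace (U ^ i) * trace (U ^ (k - i)) - B.η * trace (U ^ (k - 2 * i : ℤ).natAbs)) := by
  have h : ∑ x, ∑ y, ∑ i ∈ Finset.range k,
      trace (B.lieElt y x * U ^ i * B.lieElt x y * U ^ (k - i)) = ∑ i ∈ Finset.range k,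
      (2 * trace (U ^ i) * trace (U ^ (k - i)) -
        2 * B.η * trace (U ^ (k - 2 * i : ℤ).natAbs)) := by
    rw [Finset.sum_comm]
    simp only [Finset.sum_comm (t := Finset.range k)]
    refine Finset.sum_congr rfl fun i hi => ?_
    rw [Finset.mem_range] at hi
    rw [B.sum_trace_lieElt_mul_lieElt, hU.trace_sharp_pow_mul_pow]
    congr 4
    omega
  simp only [laplacian_apply, tracePoly_X, map_mul, map_sum, map_ofNat,
    entryEval_invDeriv_invDeriv_trace_pow, ← Finset.mul_sum, h]
  rw [Finset.mul_sum, Finset.mul_sum, Finset.mul_sum]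
  exact Finset.sum_congr rfl fun i _ => by ring

end BilinForm

end

section

variable {m : ℕ}

lemma torusGrad_add_left (f f' g : Laurent m) :
    torusGrad (f + f') g = torusGrad f g + torusGrad f' g := by
  simp only [torusGrad, map_add, add_mul, Finset.sum_add_distrib]

lemma torusGrad_comm (f g : Laurent m) : torusGrad f g = torusGrad g f := by
  simp only [torusGrad, mul_comm]

lemma torusGrad_mul_left (f f' g : Laurent m) :
    torusGrad (f * f') g = f * torusGrad f' g + f' * torusGrad f g := by
  simp only [torusGrad, Derivation.leibniz, smul_eq_mul, add_mul, Finset.sum_add_distrib,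
    Finset.mul_sum, mul_assoc]

lemma torusGrad_algebraMap_left (c : ℂ) (g : Laurent m) : torusGrad (algebraMap ℂ _ c) g = 0 := by
  simp only [torusGrad, Derivation.map_algebraMap, zero_mul, Finset.sum_const_zero]

lemma lap_algebraMap (c : ℂ) : lap (algebraMap ℂ (Laurent m) c) = 0 := by
  simp only [lap_eq, Derivation.map_algebraMap, map_zero, Finset.sum_const_zero]

lemma torusEval_X (t : WeylType) (k : ℕ) :
    torusEval t m (MvPolynomial.X k) = fullSum t m k := by
  simp [torusEval]

lemma torusEval_C (t : WeylType) (c : ℂ) :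
    torusEval t m (MvPolynomial.C c) = algebraMap ℂ _ c := by
  simp [torusEval]

variable {ι : Type*} [Fintype ι] [DecidableEq ι] (B : BilinForm ι)

/-- Class polynomials evaluated at a matrix. -/
def classEval (U : Matrix ι ι ℂ) : MvPolynomial ℕ ℂ →ₐ[ℂ] ℂ :=
  (entryEval U).comp (tracePoly ι)

lemma classEval_X (U : Matrix ι ι ℂ) (k : ℕ) : classEval U (.X k) = trace (U ^ k) := by
  rw [classEval, AlgHom.comp_apply, tracePoly_X, entryEval_trace_pow]

lemma classEval_apply (U : Matrix ι ι ℂ) (f : MvPolynomial ℕ ℂ) :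
    classEval U f = entryEval U (tracePoly ι f) := rfl

namespace BilinForm

lemma exists_gradient_eq (t : WeylType) (m : ℕ) (f g : MvPolynomial ℕ ℂ) :
    ∃ h : MvPolynomial ℕ ℂ,
      (∀ U, B.IsIsometry U → entryEval U (B.gradient (tracePoly ι f) (tracePoly ι g)) =
        classEval U h) ∧
      torusGrad (torusEval t m f) (torusEval t m g) = torusEval t m h := by
  induction f using MvPolynomial.induction_on with
  | C c =>
    refine ⟨0, fun U _ => ?_, ?_⟩
    · rw [tracePoly, MvPolynomial.aeval_C, MvPolynomial.algebraMap_eq, gradient_C_left, map_zero,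
        map_zero]
    · rw [torusEval_C, torusGrad_algebraMap_left, map_zero]
  | add f f' ih ih' =>
    obtain ⟨h, h1, h2⟩ := ih
    obtain ⟨h', h1', h2'⟩ := ih'
    refine ⟨h + h', fun U hU => ?_, ?_⟩
    · rw [map_add, gradient_add_left, map_add, h1 U hU, h1' U hU, map_add]
    · rw [map_add, torusGrad_add_left, h2, h2', map_add]
  | mul_X f k ih =>
    obtain ⟨h, h1, h2⟩ := ih
    obtain ⟨h', h1', h2'⟩ : ∃ h : MvPolynomial ℕ ℂ,
      (∀ U, B.IsIsometry U → entryEval U (B.gradient (tracePoly ι (.X k)) (tracePoly ι g)) =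
        classEval U h) ∧
      torusGrad (torusEval t m (.X k)) (torusEval t m g) = torusEval t m h := by
      clear h1 h2
      induction g using MvPolynomial.induction_on with
      | C c =>
        refine ⟨0, fun U _ => ?_, ?_⟩
        · rw [gradient_comm, tracePoly, MvPolynomial.aeval_C, MvPolynomial.algebraMap_eq,
            gradient_C_left, map_zero, map_zero]
        · rw [torusGrad_comm, torusEval_C, torusGrad_algebraMap_left, map_zero]
      | add f f' ih ih' =>
        obtain ⟨h, h1, h2⟩ := ih
        obtain ⟨h', h1', h2'⟩ := ih'
        refine ⟨h + h', fun U hU => ?_, ?_⟩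
        · rw [gradient_comm, map_add, gradient_add_left, map_add, gradient_comm, h1 U hU,
            gradient_comm, h1' U hU, map_add]
        · rw [torusGrad_comm, map_add, torusGrad_add_left, torusGrad_comm, h2, torusGrad_comm, h2',
            map_add]
      | mul_X f l ih =>
        obtain ⟨h, h1, h2⟩ := ih
        refine ⟨f * (4 * (k : MvPolynomial ℕ ℂ) * (l : MvPolynomial ℕ ℂ) *
          (MvPolynomial.X (k + l) - MvPolynomial.X (k - l : ℤ).natAbs)) + MvPolynomial.X l * h,
          fun U hU => ?_, ?_⟩
        · rw [gradient_comm, map_mul, gradient_mul_left, map_add, map_mul, map_mul, gradient_comm,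
            hU.entryEval_gradient, gradient_comm, h1 U hU]
          simp only [map_add, map_mul, map_sub, classEval_X, ← classEval_apply,
            map_natCast, map_ofNat]
        · rw [torusGrad_comm, map_mul, torusGrad_mul_left, torusGrad_comm, torusEval_X,
            torusEval_X, torusGrad_fullSum, torusGrad_comm, ← torusEval_X t k, h2]
          simp only [map_add, map_mul, map_sub, torusEval_X, map_natCast, map_ofNat]
    refine ⟨f * h' + .X k * h, fun U hU => ?_, ?_⟩
    · rw [map_mul, gradient_mul_left, map_add, map_mul, map_mul, h1 U hU, h1' U hU]
      simp only [map_add, map_mul, ← classEval_apply]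
    · rw [map_mul, torusGrad_mul_left, h2, h2']
      simp only [map_add, map_mul]

lemma exists_laplacian_eq (t : WeylType) (m : ℕ) (hη : B.η = t.η) (f : MvPolynomial ℕ ℂ) :
    ∃ f' : MvPolynomial ℕ ℂ,
      (∀ U, B.IsIsometry U → entryEval U (B.laplacian (tracePoly ι f)) = classEval U f') ∧
      torusEval t m f' * weyl t m =
        lap (torusEval t m f) * weyl t m + 2 * torusGrad (torusEval t m f) (weyl t m) := by
  induction f using MvPolynomial.induction_on with
  | C c =>
    refine ⟨0, fun U _ => ?_, ?_⟩
    · rw [tracePoly, MvPolynomial.aeval_C, MvPolynomial.algebraMap_eq, laplacian_C, map_zero,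
        map_zero]
    · rw [torusEval_C, torusGrad_algebraMap_left, lap_algebraMap, map_zero, zero_mul, mul_zero,
        add_zero]
  | add f g ih ih' =>
    obtain ⟨h, h1, h2⟩ := ih
    obtain ⟨h', h1', h2'⟩ := ih'
    refine ⟨h + h', fun U hU => ?_, ?_⟩
    · rw [map_add, map_add, map_add, h1 U hU, h1' U hU, map_add]
    · rw [map_add, map_add, torusGrad_add_left, map_add, add_mul, h2, h2']
      ring
  | mul_X f k ih =>
    obtain ⟨h, h1, h2⟩ := ih
    obtain ⟨h', h1', h2'⟩ := B.exists_gradient_eq t m f (.X k)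
    refine ⟨f * (4 * (k : MvPolynomial ℕ ℂ) * ∑ i ∈ Finset.range k,
      (.X i * .X (k - i) - (t.η : MvPolynomial ℕ ℂ) * .X (k - 2 * i : ℤ).natAbs)) + .X k * h +
        2 * h', fun U hU => ?_, ?_⟩
    · rw [map_mul, laplacian_mul, map_add, map_add, map_mul, map_mul, map_mul, h1 U hU, h1' U hU,
        hU.entryEval_laplacian, hη]
      simp only [map_add, map_mul, map_sub, map_sum, classEval_X, ← classEval_apply, map_ofNat,
        map_natCast, map_intCast]
    · have h3 : torusEval t m (4 * (k : MvPolynomial ℕ ℂ) * ∑ i ∈ Finset.range k,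
          (.X i * .X (k - i) - (t.η : MvPolynomial ℕ ℂ) * .X (k - 2 * i : ℤ).natAbs)) * weyl t m =
          lap (fullSum t m k) * weyl t m + 2 * torusGrad (fullSum t m k) (weyl t m) := by
        rw [lap_fullSum_mul_weyl]
        simp only [map_mul, map_sub, map_sum, torusEval_X, map_natCast, map_ofNat, map_intCast]
      rw [map_mul _ f (.X k), lap_mul, torusGrad_mul_left, map_add, map_add, map_mul _ f,
        map_mul _ _ h, map_mul _ 2 h', map_ofNat, ← h2', torusEval_X]
      linear_combination torusEval t m f * h3 + fullSum t m k * h2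

lemma exists_laplacian_eq' (t : WeylType) (m : ℕ) (hη : B.η = t.η) (f : MvPolynomial ℕ ℂ) :
    ∃ f' : MvPolynomial ℕ ℂ,
      (∀ U, B.IsIsometry U → entryEval U (B.laplacian (tracePoly ι f)) = classEval U f') ∧
      torusEval t m f' * weyl t m = lap (torusEval t m f * weyl t m) -
        (rhoSq t m : ℂ) • (torusEval t m f * weyl t m) := by
  obtain ⟨f', h1, h2⟩ := B.exists_laplacian_eq t m hη f
  refine ⟨f', h1, ?_⟩
  rw [h2, lap_mul, lap_weyl, mul_smul_comm]
  ring

end BilinForm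

end

section

variable {ι : Type*} [Fintype ι] [DecidableEq ι]

open Polynomial in
lemma det_aeval_eq_prod_roots (A : Matrix ι ι ℂ) (q : ℂ[X]) :
    det (aeval A q) = (A.charpoly.roots.map fun x => q.eval x).prod := by
  have hcard : A.charpoly.roots.card = Fintype.card ι := by
    rw [← (IsAlgClosed.splits A.charpoly).natDegree_eq_card_roots, charpoly_natDegree_eq_dim]
  have hlin : ∀ r : ℂ, det (aeval A (X - C r)) =
      (A.charpoly.roots.map fun x => (X - C r).eval x).prod := by
    intro r
    have h1 : A.charpoly.eval r = (A.charpoly.roots.map fun x => r - x).prod := by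
      conv_lhs => rw [(IsAlgClosed.splits A.charpoly).eq_prod_roots_of_monic A.charpoly_monic]
      simp [eval_multiset_prod, Multiset.map_map]
    rw [eval_charpoly] at h1
    have h2 : aeval A (X - C r) = -(scalar ι r - A) := by
      simp [Algebra.algebraMap_eq_smul_one, smul_one_eq_diagonal]
    rw [h2, det_neg, h1, ← hcard, ← Multiset.prod_replicate, ← Multiset.map_const',
      ← Multiset.prod_map_mul]
    simp
  have hq := (IsAlgClosed.splits q).eq_prod_roots
  rw [hq]
  induction q.roots using Multiset.induction_on with
  | empty => simp [Algebra.algebraMap_eq_smul_one, hcard]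
  | cons r s ih =>
    rw [Multiset.map_cons, Multiset.prod_cons, mul_left_comm, map_mul, det_mul, ih, hlin,
      ← Multiset.prod_map_mul]
    simp only [eval_mul]

lemma roots_charpoly_pow (A : Matrix ι ι ℂ) (k : ℕ) :
    (A ^ k).charpoly.roots = A.charpoly.roots.map (· ^ k) := by
  have h : (A ^ k).charpoly =
      ((A.charpoly.roots.map (· ^ k)).map fun x => Polynomial.X - Polynomial.C x).prod := by
    refine Polynomial.funext fun x => ?_
    have h := det_aeval_eq_prod_roots A (Polynomial.C x - Polynomial.X ^ k)
    have h2 : Polynomial.aeval A (Polynomial.C x - Polynomial.X ^ k) = scalar ι x - A ^ k := by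
      simp [Algebra.algebraMap_eq_smul_one, smul_one_eq_diagonal]
    rw [eval_charpoly, ← h2, h, Polynomial.eval_multiset_prod, Multiset.map_map, Multiset.map_map]
    simp
  rw [h, Polynomial.roots_multiset_prod_X_sub_C]

lemma roots_charpoly_inv {A : Matrix ι ι ℂ} (hA : det A ≠ 0) :
    A⁻¹.charpoly.roots = A.charpoly.roots.map (·⁻¹) := by
  have h0 : (0 : ℂ) ∉ A.charpoly.roots := fun h => hA (by
    rw [det_eq_prod_roots_charpoly, Multiset.prod_eq_zero h])
  have h : A⁻¹.charpoly =
      ((A.charpoly.roots.map (·⁻¹)).map fun x => Polynomial.X - Polynomial.C x).prod := by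
    refine Polynomial.funext fun x => mul_right_cancel₀ hA ?_
    have h := det_aeval_eq_prod_roots A (Polynomial.C x * Polynomial.X - 1)
    have h2 : Polynomial.aeval A (Polynomial.C x * Polynomial.X - 1) =
        (scalar ι x - A⁻¹) * A := by
      rw [sub_mul, nonsing_inv_mul _ (isUnit_iff_ne_zero.2 hA)]
      simp [Algebra.algebraMap_eq_smul_one, smul_one_eq_diagonal]
    rw [eval_charpoly, ← det_mul, ← h2, h, det_eq_prod_roots_charpoly,
      Polynomial.eval_multiset_prod, Multiset.map_map, Multiset.map_map]
    conv_rhs => rw [← Multiset.map_id A.charpoly.roots, Multiset.map_map, ← Multiset.prod_map_mul]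
    refine congrArg _ (Multiset.map_congr rfl fun y hy => ?_)
    have hy0 : y ≠ 0 := fun h => h0 (h ▸ hy)
    simp [sub_mul, hy0]
  rw [h, Polynomial.roots_multiset_prod_X_sub_C]

lemma trace_pow_eq_sum_roots (A : Matrix ι ι ℂ) (k : ℕ) :
    trace (A ^ k) = (A.charpoly.roots.map (· ^ k)).sum := by
  rw [trace_eq_sum_roots_charpoly, roots_charpoly_pow]

lemma exists_pairing (R : Multiset ℂ) (h0 : (0 : ℂ) ∉ R) (hR : R.map (·⁻¹) = R) :
    ∃ X T : Multiset ℂ, R = X + X.map (·⁻¹) + T ∧ T.Nodup ∧ ∀ x ∈ T, x = 1 ∨ x = -1 := by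
  induction hn : R.card using Nat.strong_induction_on generalizing R with
  | _ n ih =>
  by_cases h : ∃ x ∈ R, x⁻¹ ∈ R.erase x
  · obtain ⟨x, hx, hx'⟩ := h
    obtain ⟨S, hS⟩ := Multiset.exists_cons_of_mem hx
    rw [hS, Multiset.erase_cons_head] at hx'
    obtain ⟨S, rfl⟩ := Multiset.exists_cons_of_mem hx'
    subst hS
    obtain ⟨X, T, hXT, hT⟩ := ih S.card (by simp at hn; omega) S
      (fun h => h0 (Multiset.mem_cons_of_mem (Multiset.mem_cons_of_mem h))) (by
        simp only [Multiset.map_cons, inv_inv] at hR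
        rw [Multiset.cons_swap] at hR
        simpa using hR) rfl
    refine ⟨x ::ₘ X, T, ?_, hT⟩
    conv_lhs => rw [hXT]
    simp only [Multiset.map_cons, Multiset.cons_add, Multiset.add_cons]
    rw [Multiset.cons_swap]
  · push Not at h
    refine ⟨0, R, by simp, ?_, fun x hx => ?_⟩
    · rw [Multiset.nodup_iff_count_le_one]
      intro x
      by_contra! hc
      have hx : x ∈ R := Multiset.count_pos.1 (by omega)
      have h1 : R.count x⁻¹ = R.count x := by
        conv_lhs => rw [← hR]
        exact Multiset.count_map_eq_count' _ _ inv_injective x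
      apply h x hx
      rw [← Multiset.count_pos]
      by_cases hxx : x⁻¹ = x
      · rw [hxx, Multiset.count_erase_self]; omega
      · rw [Multiset.count_erase_of_ne hxx]; omega
    · have h1 : x⁻¹ ∈ R := by
        rw [← hR]; exact Multiset.mem_map_of_mem _ hx
      have hxx : x⁻¹ = x := by
        by_contra hne
        exact h x hx ((Multiset.mem_erase_of_ne hne).2 h1)
      have hx0 : x ≠ 0 := fun h => h0 (h ▸ hx)
      have h2 : x * x = 1 := by
        calc x * x = x * x⁻¹ := by rw [hxx]
          _ = 1 := mul_inv_cancel₀ hx0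
      exact mul_self_eq_one_iff.1 h2

lemma exists_fin_map_eq (X : Multiset ℂ) :
    ∃ x : Fin X.card → ℂ, Finset.univ.val.map x = X := by
  induction X using Quotient.inductionOn with
  | _ l => exact ⟨l.get, by
    change Multiset.map l.get Finset.univ.val = _
    rw [Fin.univ_val_map, List.ofFn_get]
    rfl⟩

lemma exists_eigenvalues (t : WeylType) {m : ℕ} {A : Matrix ι ι ℂ}
    (hcard : Fintype.card ι = 2 * m + t.α + t.β) (hdet : det A = (-1) ^ t.β)
    (hA : A⁻¹.charpoly = A.charpoly) :
    ∃ x : Fin m → ℂ, (∀ a, x a ≠ 0) ∧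
      ∀ k, trace (A ^ k) = ∑ a, (x a ^ k + (x a)⁻¹ ^ k) + t.s k := by
  set R := A.charpoly.roots with hRdef
  have hprod : R.prod = (-1) ^ t.β := by rw [← hdet, det_eq_prod_roots_charpoly]
  have hne : det A ≠ 0 := by rw [hdet]; simp
  have h0 : (0 : ℂ) ∉ R := fun h => hne (by
    rw [det_eq_prod_roots_charpoly, Multiset.prod_eq_zero h])
  have hRcard : R.card = 2 * m + t.α + t.β := by
    rw [← hcard, ← (IsAlgClosed.splits A.charpoly).natDegree_eq_card_roots,
      charpoly_natDegree_eq_dim]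
  have hR : R.map (·⁻¹) = R := by rw [hRdef, ← roots_charpoly_inv hne, hA]
  obtain ⟨X, T, hXT, hT, hT'⟩ := exists_pairing R h0 hR
  have hTeq : T = Multiset.replicate (T.count 1) 1 + Multiset.replicate (T.count (-1)) (-1) := by
    ext x
    rw [Multiset.count_add, Multiset.count_replicate, Multiset.count_replicate]
    by_cases hx : x ∈ T
    · rcases hT' x hx with rfl | rfl
      · rw [if_pos rfl, if_neg (by norm_num), add_zero]
      · rw [if_neg (by norm_num), if_pos rfl, zero_add]
    · rw [Multiset.count_eq_zero_of_notMem hx]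
      split_ifs with h1 h2 h2
      · norm_num [← h2] at h1
      · subst h1; simp [hx]
      · subst h2; simp [hx]
      · rfl
  have ha := Multiset.nodup_iff_count_le_one.1 hT 1
  have hb := Multiset.nodup_iff_count_le_one.1 hT (-1)
  set a := T.count 1
  set b := T.count (-1)
  have hX0 : ∀ x ∈ X, x ≠ 0 := fun x hx h => h0 (by
    rw [hXT, ← h]; exact Multiset.mem_add.2 (Or.inl (Multiset.mem_add.2 (Or.inl hx))))
  have hXprod : (X + X.map (·⁻¹)).prod = 1 := by
    rw [Multiset.prod_add, ← Multiset.map_id X, Multiset.map_map, ← Multiset.prod_map_mul]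
    refine Multiset.prod_eq_one fun y hy => ?_
    obtain ⟨x, hx, rfl⟩ := Multiset.mem_map.1 hy
    simp [hX0 x hx]
  rw [hXT, Multiset.prod_add, hXprod, one_mul, hTeq, Multiset.prod_add, Multiset.prod_replicate,
    Multiset.prod_replicate, one_pow, one_mul] at hprod
  have hcardX : X.card + X.card + (a + b) = 2 * m + t.α + t.β := by
    rw [← hRcard, hXT, hTeq]
    simp
  have hα : t.α ≤ 1 := by cases t <;> simp [WeylType.α]
  have hβ : t.β ≤ 1 := by cases t <;> simp [WeylType.β]
  have hbβ : b = t.β := by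
    interval_cases b <;> interval_cases t.β <;> first | rfl | norm_num at hprod
  have haα : a = t.α := by omega
  have hXm : X.card = m := by omega
  subst hXm
  obtain ⟨x, hx⟩ := exists_fin_map_eq X
  refine ⟨x, fun a => hX0 _ (by rw [← hx]; exact Multiset.mem_map_of_mem _ (Finset.mem_univ a)),
    fun k => ?_⟩
  rw [trace_pow_eq_sum_roots, ← hRdef, hXT, hTeq, hbβ, haα]
  simp only [Multiset.map_add, Multiset.sum_add, Multiset.map_replicate, Multiset.sum_replicate,
    Multiset.map_map]
  rw [Finset.sum_add_distrib, WeylType.s]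
  have e1 : (X.map fun x => x ^ k).sum = ∑ a, x a ^ k := by
    conv_lhs => rw [← hx]
    rw [Multiset.map_map]
    rfl
  have e2 : (X.map ((fun x => x ^ k) ∘ fun x => x⁻¹)).sum = ∑ a, (x a)⁻¹ ^ k := by
    conv_lhs => rw [← hx]
    rw [Multiset.map_map]
    rfl
  rw [e1, e2]
  simp

/-- Evaluation of Laurent polynomials at a point of the complex torus. -/
def laurentEval {m : ℕ} (z : Fin m → ℂˣ) : Laurent m →ₐ[ℂ] ℂ :=
  AddMonoidAlgebra.lift ℂ ℂ (Fin m → ℤ)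
    { toFun := fun v => ((∏ a, z a ^ (v.toAdd a) : ℂˣ) : ℂ)
      map_one' := by simp
      map_mul' := fun v w => by simp [_root_.zpow_add, Finset.prod_mul_distrib] }

lemma laurentEval_zp {m : ℕ} (z : Fin m → ℂˣ) (a : Fin m) (n : ℤ) :
    laurentEval z (zp a n) = ((z a ^ n : ℂˣ) : ℂ) := by
  rw [laurentEval, zp, AddMonoidAlgebra.lift_single, one_smul]
  simp only [MonoidHom.coe_mk, OneHom.coe_mk, toAdd_ofAdd]
  rw [Finset.prod_eq_single a (fun b _ h => by simp [h]) (by simp)]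
  simp

/-- A class function on matrices of the given type factors through the torus. -/
lemma exists_classEval_eq (t : WeylType) {m : ℕ} {A : Matrix ι ι ℂ}
    (hcard : Fintype.card ι = 2 * m + t.α + t.β) (hdet : det A = (-1) ^ t.β)
    (hA : A⁻¹.charpoly = A.charpoly) :
    ∃ φ : Laurent m →ₐ[ℂ] ℂ, ∀ f, classEval A f = φ (torusEval t m f) := by
  obtain ⟨x, hx0, hx⟩ := exists_eigenvalues t hcard hdet hA
  choose z hz using fun a => IsAlgClosed.exists_pow_nat_eq (x a) two_pos
  have hz0 : ∀ a, z a ≠ 0 := fun a h => hx0 a (by rw [← hz, h]; simp)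
  refine ⟨laurentEval fun a => Units.mk0 (z a) (hz0 a), fun f => ?_⟩
  rw [← AlgHom.comp_apply]
  congr 1
  refine MvPolynomial.algHom_ext fun k => ?_
  rw [classEval_X, AlgHom.comp_apply, torusEval_X, fullSum, powSum, hx]
  simp only [map_add, map_sum, laurentEval_zp, map_intCast]
  congr 1
  refine Finset.sum_congr rfl fun a _ => ?_
  rw [← hz a, _root_.zpow_neg]
  push_cast
  rw [Units.val_mk0, _root_.zpow_mul, zpow_ofNat, zpow_natCast, inv_pow]

variable {B : BilinForm ι}

lemma BilinForm.IsIsometry.charpoly_inv {U : Matrix ι ι ℂ} (hU : B.IsIsometry U) :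
    U⁻¹.charpoly = U.charpoly := by
  rw [inv_eq_right_inv hU.mul_sharp, BilinForm.sharp, charpoly_mul_comm, ← mul_assoc,
    B.conjTranspose_mul, one_mul, charpoly_transpose]

lemma BilinForm.IsIsometry.det_mul_det {U : Matrix ι ι ℂ} (hU : B.IsIsometry U) :
    det U * det U = 1 := by
  have h := congrArg det hU.mul_sharp
  rw [det_mul, BilinForm.sharp, det_mul_comm, ← mul_assoc, B.conjTranspose_mul, one_mul,
    det_transpose, det_one] at h
  exact h

end

section

variable {ι : Type*} [Fintype ι] [DecidableEq ι]

lemma entryEval_invDeriv_X {ι : Type*} [Fintype ι] (Z : Matrix ι ι ℂ) (i j : ι) (U : Matrix ι ι ℂ) :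
    entryEval U (invDeriv Z (MvPolynomial.X (i, j))) = (Z * U) i j := by
  simp [invDeriv, entryEval, genMat, Matrix.mul_apply]

lemma invDeriv_add {ι : Type*} [Fintype ι] (Z W : Matrix ι ι ℂ) :
    invDeriv (Z + W) = invDeriv Z + invDeriv W := by
  refine MvPolynomial.derivation_ext fun p => ?_
  simp [invDeriv, Matrix.mul_apply, add_mul, Finset.sum_add_distrib]

lemma invDeriv_smul {ι : Type*} [Fintype ι] (c : ℂ) (Z : Matrix ι ι ℂ) :
    invDeriv (c • Z) = c • invDeriv Z := by
  refine MvPolynomial.derivation_ext fun p => ?_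
  simp [invDeriv, Matrix.mul_apply, Finset.mul_sum, mul_assoc, MvPolynomial.smul_eq_C_mul]

lemma measurable_entry {ι R : Type*} [MeasurableSpace R] (i j : ι) :
    Measurable fun U : Matrix ι ι R => U i j :=
  (measurable_pi_apply j).comp (measurable_pi_apply i)

lemma measurable_entryEval {ι : Type*} (h : EntryPoly ι) :
    Measurable fun U : Matrix ι ι ℂ => entryEval U h := by
  induction h using MvPolynomial.induction_on with
  | C a => simp [entryEval]
  | add p q hp hq => simp only [map_add]; exact hp.add hq
  | mul_X p s hp =>
    simp only [map_mul]
    refine hp.mul ?_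
    simpa [entryEval] using measurable_entry s.1 s.2

lemma exists_norm_entryEval_le (h : EntryPoly ι) :
    ∃ C : ℝ, ∀ U ∈ unitaryGroup ι ℂ, ‖entryEval U h‖ ≤ C := by
  induction h using MvPolynomial.induction_on with
  | C a => exact ⟨‖a‖, fun U _ => by simp [entryEval]⟩
  | add p q hp hq =>
    obtain ⟨C, hC⟩ := hp
    obtain ⟨D, hD⟩ := hq
    exact ⟨C + D, fun U hU => by
      rw [map_add]; exact (norm_add_le _ _).trans (add_le_add (hC U hU) (hD U hU))⟩
  | mul_X p s hp =>
    obtain ⟨C, hC⟩ := hp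
    refine ⟨C, fun U hU => ?_⟩
    rw [map_mul, norm_mul]
    have h1 : ‖entryEval U (MvPolynomial.X s)‖ ≤ 1 := by
      simpa [entryEval] using entry_norm_bound_of_unitary hU s.1 s.2
    exact (mul_le_of_le_one_right (norm_nonneg _) h1).trans (hC U hU)

lemma integrable_entryEval {ν : Measure (Matrix ι ι ℂ)} [IsFiniteMeasure ν]
    (hν : ∀ᵐ U ∂ν, U ∈ unitaryGroup ι ℂ) (h : EntryPoly ι) :
    Integrable (fun U => entryEval U h) ν := by
  obtain ⟨C, hC⟩ := exists_norm_entryEval_le h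
  exact Integrable.of_bound (measurable_entryEval h).aestronglyMeasurable C
    (hν.mono fun U hU => hC U hU)

section Exp

open NormedSpace (exp)

attribute [local instance] Matrix.linftyOpNormedRing Matrix.linftyOpNormedAlgebra

lemma hasDerivAt_exp_smul_apply (Y : Matrix ι ι ℂ) (s : ℝ) (i j : ι) :
    HasDerivAt (fun s : ℝ => exp (s • Y) i j) ((Y * exp (s • Y)) i j) s := by
  have h := hasDerivAt_exp_smul_const' (𝕂 := ℝ) Y s
  exact hasDerivAt_pi.1 (hasDerivAt_pi.1 h i) j

end Exp

open NormedSpace (exp)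

lemma hasDerivAt_entryEval_exp (Y U : Matrix ι ι ℂ) (h : EntryPoly ι) (s : ℝ) :
    HasDerivAt (fun s : ℝ => entryEval (exp (s • Y) * U) h)
      (entryEval (exp (s • Y) * U) (invDeriv Y h)) s := by
  induction h using MvPolynomial.induction_on with
  | C a => simpa [entryEval] using hasDerivAt_const s a
  | add p q hp hq => simp only [map_add]; exact hp.add hq
  | mul_X p q hp =>
    have hq : HasDerivAt (fun s : ℝ => entryEval (exp (s • Y) * U) (MvPolynomial.X q))
        (entryEval (exp (s • Y) * U) (invDeriv Y (MvPolynomial.X q))) s := by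
      rw [entryEval_invDeriv_X, ← mul_assoc]
      simp only [entryEval, MvPolynomial.aeval_X]
      rw [Matrix.mul_apply]
      simp only [Matrix.mul_apply (N := U)]
      exact HasDerivAt.fun_sum fun l _ =>
        (hasDerivAt_exp_smul_apply Y s q.1 l).mul_const (U l q.2)
    simp only [map_mul]
    refine (hp.fun_mul hq).congr_deriv ?_
    rw [Derivation.leibniz, map_add, smul_eq_mul, smul_eq_mul, map_mul, map_mul]
    ring

lemma exp_mem_unitaryGroup {Y : Matrix ι ι ℂ} (hY : Yᴴ = -Y) : exp Y ∈ unitaryGroup ι ℂ := by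
  rw [mem_unitaryGroup_iff, star_eq_conjTranspose, ← exp_conjTranspose, hY, Matrix.exp_neg,
    mul_nonsing_inv _ ((isUnit_iff_isUnit_det _).1 (Matrix.isUnit_exp Y))]

namespace BilinForm

variable (B : BilinForm ι)

/-- The unitary isometries of determinant one. -/
structure IsSpecial (V : Matrix ι ι ℂ) : Prop where
  mem_unitaryGroup : V ∈ unitaryGroup ι ℂ
  isIsometry : B.IsIsometry V
  det_eq_one : det V = 1

lemma inv_J : B.J⁻¹ = B.Jᴴ := inv_eq_right_inv B.mul_conjTranspose

lemma sharp_exp (Y : Matrix ι ι ℂ) : B.sharp (exp Y) = exp (B.sharp Y) := by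
  rw [sharp, sharp, ← inv_J, Matrix.exp_conj _ _ (IsUnit.of_mul_eq_one _ B.mul_conjTranspose),
    exp_transpose]

lemma isIsometry_of_mul_sharp {V : Matrix ι ι ℂ} (h : V * B.sharp V = 1) : B.IsIsometry V := by
  calc V * B.J * Vᵀ = V * B.J * Vᵀ * (B.Jᴴ * B.J) := by rw [B.conjTranspose_mul, mul_one]
    _ = V * B.sharp V * B.J := by simp only [sharp, mul_assoc]
    _ = B.J := by rw [h, one_mul]

lemma isIsometry_exp {Y : Matrix ι ι ℂ} (hY : B.sharp Y = -Y) : B.IsIsometry (exp Y) := by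
  apply isIsometry_of_mul_sharp
  rw [B.sharp_exp, hY, Matrix.exp_neg,
    mul_nonsing_inv _ ((isUnit_iff_isUnit_det _).1 (Matrix.isUnit_exp Y))]

lemma isSpecial_exp {Y : Matrix ι ι ℂ} (hY : Yᴴ = -Y) (hY' : B.sharp Y = -Y) :
    B.IsSpecial (exp Y) := by
  refine ⟨exp_mem_unitaryGroup hY, B.isIsometry_exp hY', ?_⟩
  have h : Y = 2 • ((1 / 2 : ℂ) • Y) := by
    rw [← Nat.cast_smul_eq_nsmul ℂ, smul_smul]; norm_num
  rw [h, Matrix.exp_nsmul, pow_two, det_mul]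
  exact (B.isIsometry_exp (by rw [B.sharp_smul, hY', smul_neg])).det_mul_det

/-- A finite measure on a coset of the special unitary isometries, invariant under them. -/
structure IsInvariant (t : WeylType) (ν : Measure (Matrix ι ι ℂ)) : Prop where
  ae_mem_unitaryGroup : ∀ᵐ U ∂ν, U ∈ unitaryGroup ι ℂ
  ae_isIsometry : ∀ᵐ U ∂ν, B.IsIsometry U
  ae_det : ∀ᵐ U ∂ν, det U = (-1) ^ t.β
  map_mul_left : ∀ V, B.IsSpecial V → ν.map (V * ·) = ν

variable {B} {t : WeylType} {ν : Measure (Matrix ι ι ℂ)}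

lemma measurable_mul_left {ι R : Type*} [Fintype ι] [NonUnitalNonAssocSemiring R]
    [MeasurableSpace R] [MeasurableMul R] [MeasurableAdd₂ R] (V : Matrix ι ι R) :
    Measurable fun U : Matrix ι ι R => V * U := by
  refine measurable_pi_lambda _ fun i => measurable_pi_lambda _ fun j => ?_
  simp only [Matrix.mul_apply]
  exact Finset.measurable_sum _ fun l _ =>
    (measurable_entry l j).const_mul _

lemma IsInvariant.integral_mul_left (hν : B.IsInvariant t ν) {V : Matrix ι ι ℂ}
    (hV : B.IsSpecial V) (h : EntryPoly ι) :
    ∫ U, entryEval (V * U) h ∂ν = ∫ U, entryEval U h ∂ν := by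
  conv_rhs => rw [← hν.map_mul_left V hV]
  rw [integral_map (measurable_mul_left V).aemeasurable
    (measurable_entryEval h).aestronglyMeasurable]

variable [IsFiniteMeasure ν]

lemma IsInvariant.integral_invDeriv_of_skew (hν : B.IsInvariant t ν) {Y : Matrix ι ι ℂ}
    (hY : Yᴴ = -Y) (hY' : B.sharp Y = -Y) (h : EntryPoly ι) :
    ∫ U, entryEval U (invDeriv Y h) ∂ν = 0 := by
  have hsp : ∀ s : ℝ, B.IsSpecial (exp (s • Y)) := fun s => by
    apply B.isSpecial_exp
    · rw [conjTranspose_smul, hY]; simp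
    · rw [← Complex.coe_smul, B.sharp_smul, hY', smul_neg]
  obtain ⟨C, hC⟩ := exists_norm_entryEval_le (invDeriv Y h)
  have hd := (hasDerivAt_integral_of_dominated_loc_of_deriv_le (μ := ν) (𝕜 := ℝ) (x₀ := 0)
    (F := fun s U => entryEval (exp (s • Y) * U) h)
    (F' := fun s U => entryEval (exp (s • Y) * U) (invDeriv Y h)) (bound := fun _ => C)
    (s := Set.univ) univ_mem
    (Eventually.of_forall fun s =>
      ((measurable_entryEval h).comp (measurable_mul_left _)).aestronglyMeasurable)
    (by simpa using integrable_entryEval hν.ae_mem_unitaryGroup h)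
    ((measurable_entryEval _).comp (measurable_mul_left _)).aestronglyMeasurable
    (hν.ae_mem_unitaryGroup.mono fun U hU s _ => hC _ (mul_mem (hsp s).mem_unitaryGroup hU))
    (integrable_const C)
    (Eventually.of_forall fun U s _ => hasDerivAt_entryEval_exp Y U h s)).2
  simp only [fun s => hν.integral_mul_left (hsp s)] at hd
  exact hd.unique (hasDerivAt_const _ _)

lemma IsInvariant.integral_invDeriv (hν : B.IsInvariant t ν) {Z : Matrix ι ι ℂ}
    (hZ : B.sharp Z = -Z) (h : EntryPoly ι) :
    ∫ U, entryEval U (invDeriv Z h) ∂ν = 0 := by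
  have hZ' : B.sharp Zᴴ = -Zᴴ := by rw [B.sharp_conjTranspose, hZ, conjTranspose_neg]
  have hY : (Z - Zᴴ)ᴴ = -(Z - Zᴴ) := by simp
  have hW : (Complex.I • (Z + Zᴴ))ᴴ = -(Complex.I • (Z + Zᴴ)) := by
    simp [conjTranspose_smul, add_comm]
  have hY' : B.sharp (Z - Zᴴ) = -(Z - Zᴴ) := by rw [B.sharp_sub, hZ, hZ']; abel
  have hW' : B.sharp (Complex.I • (Z + Zᴴ)) = -(Complex.I • (Z + Zᴴ)) := by
    rw [B.sharp_smul, B.sharp_add, hZ, hZ', ← neg_add, smul_neg]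
  have e : Z = (1 / 2 : ℂ) • (Z - Zᴴ) + (-Complex.I / 2) • (Complex.I • (Z + Zᴴ)) := by
    rw [smul_smul, show -Complex.I / 2 * Complex.I = 1 / 2 by
      rw [div_mul_eq_mul_div, neg_mul, Complex.I_mul_I, neg_neg], ← smul_add, sub_add_add_cancel,
      ← two_smul ℂ Z, smul_smul]
    norm_num
  rw [e, invDeriv_add, invDeriv_smul, invDeriv_smul]
  simp only [Derivation.add_apply, Derivation.smul_apply, map_add, map_smul]
  rw [integral_add ((integrable_entryEval hν.ae_mem_unitaryGroup _).fun_smul _)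
    ((integrable_entryEval hν.ae_mem_unitaryGroup _).fun_smul _), integral_smul, integral_smul,
    hν.integral_invDeriv_of_skew hY hY', hν.integral_invDeriv_of_skew hW hW']
  simp

lemma IsInvariant.integral_laplacian (hν : B.IsInvariant t ν) (h : EntryPoly ι) :
    ∫ U, entryEval U (B.laplacian h) ∂ν = 0 := by
  have hint := integrable_entryEval hν.ae_mem_unitaryGroup
  simp only [B.laplacian_apply, map_mul, map_sum, map_ofNat]
  rw [integral_const_mul, integral_finsetSum _ fun i _ => integrable_finsetSum _ fun j _ => hint _]
  simp [integral_finsetSum _ fun j _ => hint _, hν.integral_invDeriv (B.sharp_lieElt _ _)]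

/-- The expectation of class functions, as a linear functional. -/
def IsInvariant.expect (hν : B.IsInvariant t ν) : MvPolynomial ℕ ℂ →ₗ[ℂ] ℂ where
  toFun f := ∫ U, classEval U f ∂ν
  map_add' f g := by
    have hint := integrable_entryEval hν.ae_mem_unitaryGroup
    simp only [map_add, classEval_apply]
    exact integral_add (hint _) (hint _)
  map_smul' c f := by
    simp only [map_smul, RingHom.id_apply]
    exact integral_smul _ _

lemma IsInvariant.norm_integral_trace_sq_le (hν : B.IsInvariant t ν) (hη : B.η = t.η) {m k : ℕ}
    (hcard : Fintype.card ι = 2 * m + t.α + t.β) (hk : 0 < k) :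
    ‖∫ U, trace (U ^ k) ^ 2 ∂ν‖ ≤ 8 * (min k m + 1) * ν.real Set.univ := by
  have key := functional_eq_coeff t (m := m) hν.expect (ν.real Set.univ) (fun f => by
    obtain ⟨f', hf, hf'⟩ := B.exists_laplacian_eq' t m hη f
    refine ⟨f', ?_, hf'⟩
    rw [← hν.integral_laplacian (tracePoly ι f)]
    exact (integral_congr_ae (hν.ae_isIsometry.mono fun U hU => hf U hU)).symm) (fun f c hf => by
    have h : ∀ᵐ U ∂ν, classEval U f = c := by
      filter_upwards [hν.ae_isIsometry, hν.ae_det] with U hU hdet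
      obtain ⟨φ, hφ⟩ := exists_classEval_eq t hcard hdet hU.charpoly_inv
      rw [hφ, hf, AlgHom.commutes]
      rfl
    change ∫ U, classEval U f ∂ν = _
    rw [integral_congr_ae h, integral_const, Complex.real_smul, mul_comm]) (MvPolynomial.X k ^ 2)
  have h1 : hν.expect (MvPolynomial.X k ^ 2) = ∫ U, trace (U ^ k) ^ 2 ∂ν := by
    change ∫ U, classEval U _ ∂ν = _
    simp [classEval_X]
  rw [← h1, key, norm_mul, norm_div, Complex.norm_real, Real.norm_of_nonneg measureReal_nonneg]
  refine mul_le_mul_of_nonneg_right ?_ measureReal_nonneg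
  rw [div_le_iff₀ (norm_pos_iff.2 (coeff_weyl_rho_ne_zero t m))]
  exact norm_coeff_sq_le t hk

end BilinForm

end

section

variable {ι : Type*} [Fintype ι] [DecidableEq ι]

lemma measurable_trace_pow_sq (k : ℕ) : Measurable fun U : Matrix ι ι ℂ => trace (U ^ k) ^ 2 := by
  have h := measurable_entryEval (tracePoly ι (MvPolynomial.X k ^ 2))
  simpa only [← classEval_apply, map_pow, classEval_X] using h

lemma measurable_det {R : Type*} [CommRing R] [MeasurableSpace R] [MeasurableMul₂ R]
    [MeasurableAdd₂ R] : Measurable fun U : Matrix ι ι R => det U := by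
  simp only [det_apply']
  exact Finset.measurable_sum _ fun σ _ =>
    (Finset.measurable_prod _ fun i _ => measurable_entry _ _).const_mul _

/-- The standard symmetric form. -/
def symmForm (ι : Type*) [Fintype ι] [DecidableEq ι] : BilinForm ι where
  J := 1
  η := 1
  mul_conjTranspose := by simp
  transpose_eq := by simp
  η_mul_self := by simp

/-- The embedding of real matrices into complex matrices. -/
abbrev complexify (ι : Type*) [Fintype ι] [DecidableEq ι] : Matrix ι ι ℝ →+* Matrix ι ι ℂ :=
  Complex.ofRealHom.mapMatrix

lemma measurable_complexify : Measurable (complexify ι) :=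
  measurable_pi_lambda _ fun i => measurable_pi_lambda _ fun j =>
    Complex.measurable_ofReal.comp (measurable_entry i j)

lemma mul_transpose_of_mem_orthogonalGroup {U : Matrix ι ι ℝ} (hU : U ∈ orthogonalGroup ι ℝ) :
    U * Uᵀ = 1 :=
  (mem_orthogonalGroup_iff _ _).1 hU

lemma complexify_injective : Function.Injective (complexify ι) :=
  Matrix.map_injective Complex.ofReal_injective

lemma measurableEmbedding_complexify : MeasurableEmbedding (complexify ι) :=
  have : StandardBorelSpace (Matrix ι ι ℝ) := inferInstanceAs (StandardBorelSpace (ι → ι → ℝ))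
  have : MeasurableSpace.CountablySeparated (Matrix ι ι ℂ) :=
    inferInstanceAs (MeasurableSpace.CountablySeparated (ι → ι → ℂ))
  measurable_complexify.measurableEmbedding complexify_injective

lemma det_complexify (U : Matrix ι ι ℝ) : det (complexify ι U) = ((det U : ℝ) : ℂ) :=
  (Complex.ofRealHom.map_det U).symm

lemma trace_complexify_pow (U : Matrix ι ι ℝ) (k : ℕ) :
    trace (complexify ι U ^ k) = ((trace (U ^ k) : ℝ) : ℂ) := by
  rw [← map_pow]
  simp [trace]

lemma complexify_conjTranspose (U : Matrix ι ι ℝ) :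
    (complexify ι U)ᴴ = complexify ι Uᵀ := by
  ext i j; simp

lemma complexify_transpose (U : Matrix ι ι ℝ) :
    (complexify ι U)ᵀ = complexify ι Uᵀ := rfl

lemma exists_complexify_eq {V : Matrix ι ι ℂ} (hV : (symmForm ι).IsSpecial V) :
    ∃ W ∈ orthogonalGroup ι ℝ, det W = 1 ∧ complexify ι W = V := by
  have h1 : V * Vᵀ = 1 := by simpa [BilinForm.IsIsometry, symmForm] using hV.isIsometry
  have h2 : Vᴴ = Vᵀ := by
    rw [← inv_eq_right_inv h1]
    exact (inv_eq_right_inv (mem_unitaryGroup_iff.1 hV.mem_unitaryGroup)).symm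
  have h3 : complexify ι (V.map Complex.re) = V := by
    ext i j
    exact Complex.conj_eq_iff_re.1 (congrFun (congrFun h2 j) i)
  refine ⟨V.map Complex.re, ?_, ?_, h3⟩
  · rw [mem_orthogonalGroup_iff]
    apply complexify_injective
    change complexify ι (V.map Complex.re * (V.map Complex.re)ᵀ) = _
    rw [map_mul, map_one, ← complexify_transpose, h3, h1]
  · have h := det_complexify (V.map Complex.re)
    rw [h3, hV.det_eq_one] at h
    exact_mod_cast h.symm

lemma measurableSet_det_eq (d : ℝ) : MeasurableSet {U : Matrix ι ι ℝ | det U = d} :=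
  measurable_det (measurableSet_singleton d)

lemma isInvariant_map_complexify {n : ℕ} {μ : Measure (Matrix (Fin n) (Fin n) ℝ)}
    (hμ : IsHaarON n μ) (t : WeylType) :
    (symmForm (Fin n)).IsInvariant t
      ((μ.restrict {U | det U = (-1) ^ t.β}).map (complexify (Fin n))) := by
  obtain ⟨-, hμ1, hμ2⟩ := hμ
  have hO : ∀ᵐ U ∂μ.restrict {U | det U = (-1) ^ t.β}, U ∈ orthogonalGroup (Fin n) ℝ :=
    ae_restrict_of_ae (mem_ae_iff.2 hμ1)
  have key : ∀ p : Matrix (Fin n) (Fin n) ℂ → Prop,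
      (∀ᵐ U ∂μ.restrict {U | det U = (-1) ^ t.β}, p (complexify _ U)) →
      ∀ᵐ U ∂(μ.restrict {U | det U = (-1) ^ t.β}).map (complexify (Fin n)), p U :=
    fun p hp => measurableEmbedding_complexify.ae_map_iff.2 hp
  refine ⟨key _ (hO.mono fun U hU => ?_), key _ (hO.mono fun U hU => ?_), key _ ?_,
    fun V hV => ?_⟩
  · rw [mem_unitaryGroup_iff, star_eq_conjTranspose, complexify_conjTranspose, ← map_mul,
      mul_transpose_of_mem_orthogonalGroup hU, map_one]
  · rw [BilinForm.IsIsometry, symmForm, mul_one, complexify_transpose, ← map_mul,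
      mul_transpose_of_mem_orthogonalGroup hU, map_one]
  · filter_upwards [ae_restrict_mem (measurableSet_det_eq _)] with U hU
    rw [det_complexify, hU]
    simp
  · obtain ⟨W, hW, hdet, rfl⟩ := exists_complexify_eq hV
    rw [Measure.map_map (BilinForm.measurable_mul_left _) measurable_complexify]
    have h1 : (complexify (Fin n) W * ·) ∘ complexify (Fin n) = complexify (Fin n) ∘ (W * ·) := by
      ext1 U; simp
    rw [h1, ← Measure.map_map measurable_complexify (BilinForm.measurable_mul_left _)]
    congr 1
    conv_rhs => rw [← hμ2 W hW]
    rw [Measure.restrict_map (BilinForm.measurable_mul_left _) (measurableSet_det_eq _)]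
    congr 2
    ext U
    simp [hdet]

lemma setIntegral_trace_sq_le {n m k : ℕ} {μ : Measure (Matrix (Fin n) (Fin n) ℝ)}
    (hμ : IsHaarON n μ) (t : WeylType) (hη : t.η = 1) (hn : n = 2 * m + t.α + t.β) (hk : 0 < k)
    (hn0 : 0 < n) :
    ∫ U in {U | det U = (-1) ^ t.β}, trace (U ^ k) ^ 2 ∂μ ≤ 16 * min (k : ℝ) n := by
  have := hμ.1
  set ν := μ.restrict {U | det U = (-1) ^ t.β} with hν
  have hinv := isInvariant_map_complexify hμ t
  have h := hinv.norm_integral_trace_sq_le hη.symm (m := m) (by simpa using hn) hk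
  rw [integral_map measurable_complexify.aemeasurable
    (measurable_trace_pow_sq k).aestronglyMeasurable] at h
  simp only [trace_complexify_pow, ← Complex.ofReal_pow, integral_complex_ofReal] at h
  rw [Complex.norm_real, map_measureReal_apply measurable_complexify .univ, Set.preimage_univ] at h
  refine (Real.le_norm_self _).trans (h.trans ?_)
  have h1 : ν.real Set.univ ≤ 1 := by
    rw [hν, measureReal_restrict_apply_univ]; exact measureReal_le_one
  have h2 : (min k m + 1 : ℝ) ≤ 2 * min (k : ℝ) n := by
    have : min k m + 1 ≤ 2 * min k n := by omega
    exact_mod_cast this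
  calc _ ≤ 8 * (min (k : ℝ) m + 1) * 1 := by
        push_cast
        exact mul_le_mul_of_nonneg_left h1 (by positivity)
    _ ≤ _ := by push_cast at h2; linarith

lemma exists_weylType (n b : ℕ) (hn : 0 < n) (hb : b ≤ 1) :
    ∃ (t : WeylType) (m : ℕ), t.η = 1 ∧ t.β = b ∧ n = 2 * m + t.α + t.β := by
  obtain rfl | rfl : b = 0 ∨ b = 1 := by omega
  · rcases Nat.even_or_odd' n with ⟨m, h | h⟩
    · exact ⟨.evenPlus, m, rfl, rfl, by simpa [WeylType.α, WeylType.β] using h⟩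
    · exact ⟨.oddPlus, m, rfl, rfl, by simpa [WeylType.α, WeylType.β] using h⟩
  · rcases Nat.even_or_odd' n with ⟨m, h | h⟩
    · exact ⟨.evenMinus, m - 1, rfl, rfl, by simp only [WeylType.α, WeylType.β]; omega⟩
    · exact ⟨.oddMinus, m, rfl, rfl, by simpa [WeylType.α, WeylType.β] using h⟩

lemma integral_trace_sq_le_of_isHaarON {n k : ℕ} (hk : 0 < k)
    {μ : Measure (Matrix (Fin n) (Fin n) ℝ)} (hμ : IsHaarON n μ) :
    ∫ U, trace (U ^ k) ^ 2 ∂μ ≤ 32 * min (k : ℝ) n := by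
  rcases Nat.eq_zero_or_pos n with rfl | hn
  · simp [trace]
  by_cases hint : Integrable (fun U : Matrix (Fin n) (Fin n) ℝ => trace (U ^ k) ^ 2) μ
  swap
  · rw [integral_undef hint]; positivity
  obtain ⟨t₀, m₀, hη₀, hβ₀, hn₀⟩ := exists_weylType n 0 hn (by omega)
  obtain ⟨t₁, m₁, hη₁, hβ₁, hn₁⟩ := exists_weylType n 1 hn le_rfl
  have h₀ := setIntegral_trace_sq_le hμ t₀ hη₀ hn₀ hk hn
  have h₁ := setIntegral_trace_sq_le hμ t₁ hη₁ hn₁ hk hn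
  rw [hβ₀, pow_zero] at h₀
  rw [hβ₁, pow_one] at h₁
  rw [← integral_add_compl (measurableSet_det_eq 1) hint]
  have hS : ({U : Matrix (Fin n) (Fin n) ℝ | det U = 1}ᶜ : Set _) =ᵐ[μ] {U | det U = -1} := by
    have hO : ∀ᵐ U ∂μ, U ∈ orthogonalGroup (Fin n) ℝ := mem_ae_iff.2 hμ.2.1
    filter_upwards [hO] with U hU
    have hdet : det U * det U = 1 := by
      have h := congrArg det (mul_transpose_of_mem_orthogonalGroup hU)
      rwa [det_mul, det_transpose, det_one] at h
    apply propext
    change ¬ det U = 1 ↔ det U = -1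
    rcases mul_self_eq_one_iff.1 hdet with h | h <;> rw [h] <;> norm_num
  rw [setIntegral_congr_set hS]
  linarith

/-- The standard symplectic form. -/
def sympForm (n : ℕ) : BilinForm (Fin n ⊕ Fin n) where
  J := sympJ n
  η := -1
  mul_conjTranspose := by simp [sympJ, fromBlocks_conjTranspose, fromBlocks_multiply]
  transpose_eq := by simp [sympJ, fromBlocks_transpose, fromBlocks_neg]
  η_mul_self := by simp

lemma sympJ_eq_neg_J (n : ℕ) : sympJ n = -J (Fin n) ℂ := by
  simp [sympJ, J, fromBlocks_neg]

lemma mem_symplecticGroup_iff {n : ℕ} {U : Matrix (Fin n ⊕ Fin n) (Fin n ⊕ Fin n) ℂ} :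
    U ∈ symplecticGroup (Fin n) ℂ ↔ (sympForm n).IsIsometry U := by
  change _ ↔ U * sympJ n * Uᵀ = sympJ n
  rw [SymplecticGroup.mem_iff, sympJ_eq_neg_J]
  simp

lemma inCompactSp_iff {n : ℕ} {U : Matrix (Fin n ⊕ Fin n) (Fin n ⊕ Fin n) ℂ} :
    InCompactSp n U ↔ (sympForm n).IsSpecial U := by
  constructor
  · rintro ⟨h1, h2, -⟩
    exact ⟨h1, h2, SymplecticGroup.det_eq_one (mem_symplecticGroup_iff.2 h2)⟩
  · rintro ⟨h1, h2, -⟩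
    refine ⟨h1, h2, ?_⟩
    have h := SymplecticGroup.mem_iff'.1 (mem_symplecticGroup_iff.2 h2)
    rw [sympJ_eq_neg_J]
    simpa using h

lemma BilinForm.IsSpecial.ofReal_re_trace_pow {B : BilinForm ι} {U : Matrix ι ι ℂ}
    (hU : B.IsSpecial U) (k : ℕ) : ((trace (U ^ k)).re : ℂ) = trace (U ^ k) := by
  have h : (U ^ k)ᴴ = B.sharp (U ^ k) := by
    rw [← inv_eq_right_inv (hU.isIsometry.pow k).mul_sharp]
    exact (inv_eq_right_inv (mem_unitaryGroup_iff.1 (pow_mem hU.mem_unitaryGroup k))).symm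
  have htr := B.trace_sharp (U ^ k)
  rw [← h, trace_conjTranspose] at htr
  exact Complex.conj_eq_iff_re.1 htr

lemma integral_trace_sq_le_of_isHaarSp {n k : ℕ} (hk : 0 < k)
    {μ : Measure (Matrix (Fin n ⊕ Fin n) (Fin n ⊕ Fin n) ℂ)} (hμ : IsHaarSp n μ) :
    ∫ U, (trace (U ^ k)).re ^ 2 ∂μ ≤ 16 * min (k : ℝ) n := by
  obtain ⟨hμ0, hμ1, hμ2⟩ := hμ
  rcases Nat.eq_zero_or_pos n with rfl | hn
  · simp [trace]
  have hS : ∀ᵐ U ∂μ, (sympForm n).IsSpecial U :=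
    (ae_iff.2 hμ1).mono fun U hU => inCompactSp_iff.1 hU
  have hinv : (sympForm n).IsInvariant .symp μ :=
    ⟨hS.mono fun U hU => hU.mem_unitaryGroup, hS.mono fun U hU => hU.isIsometry,
      hS.mono fun U hU => by simpa [WeylType.β] using hU.det_eq_one,
      fun V hV => hμ2 V (inCompactSp_iff.2 hV)⟩
  have h := hinv.norm_integral_trace_sq_le rfl (m := n) (by simp [WeylType.α, WeylType.β]; ring) hk
  have hre : ∀ᵐ U ∂μ, (((trace (U ^ k)).re ^ 2 : ℝ) : ℂ) = trace (U ^ k) ^ 2 := by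
    filter_upwards [hS] with U hU
    rw [Complex.ofReal_pow, hU.ofReal_re_trace_pow]
  rw [← integral_congr_ae hre, integral_complex_ofReal, Complex.norm_real] at h
  refine (Real.le_norm_self _).trans (h.trans ?_)
  have h2 : (min k n + 1 : ℝ) ≤ 2 * min (k : ℝ) n := by
    have : min k n + 1 ≤ 2 * min k n := by omega
    exact_mod_cast this
  rw [probReal_univ]
  push_cast at h2 ⊢
  linarith

end

end TraceMoment

/-- **Second-moment bound for traces of powers.**  There is a constant `C > 0` such that
for all `n` and all `k ≥ 1`: if `U` is Haar distributed on `O(n)` then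
`E[(Tr U^k)²] ≤ C · min{k, n}`, and if `U` is Haar distributed on `Sp(2n)` then
`E[(Tr U^k)²] ≤ C · min{k, n}` (the trace being real in both cases). -/
theorem trace_power_sq_expectation_le :
    ∃ C : ℝ, 0 < C ∧
      (∀ (n k : ℕ), 0 < k → ∀ μ : Measure (Matrix (Fin n) (Fin n) ℝ), IsHaarON n μ →
        (∫ U, (Matrix.trace (U ^ k)) ^ 2 ∂μ) ≤ C * min (k : ℝ) (n : ℝ)) ∧
      (∀ (n k : ℕ), 0 < k → ∀ μ : Measure (Matrix (Fin n ⊕ Fin n) (Fin n ⊕ Fin n) ℂ),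
        IsHaarSp n μ →
        (∫ U, ((Matrix.trace (U ^ k)).re) ^ 2 ∂μ) ≤ C * min (k : ℝ) (n : ℝ)) := by
  refine ⟨32, by norm_num, fun n k hk μ hμ => TraceMoment.integral_trace_sq_le_of_isHaarON hk hμ,
    fun n k hk μ hμ => (TraceMoment.integral_trace_sq_le_of_isHaarSp hk hμ).trans ?_⟩
  gcongr
  norm_num
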